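/- arXiv:1807.02713 — 16 statements merged into one kernel-verified Lean document; each statement's English description precedes it below -/
import Mathlib

section
/- Let K be a compact Hausdorff topological space and n a positive integer. For every orthogonally additive continuous n-homogeneous polynomial P on C(K) there exists a regular Borel signed measure μ on K such that P(x) = ∫_K x^n dμ for every x ∈ C(K). -/
open MeasureTheory

open scoped NNReal ENNReal CompactlySupported Pointwise

section Riesz

variable {K : Type*} [TopologicalSpace K]

theorem MeasureTheory.Measure.InnerRegular.of_le_of_isFiniteMeasure [T2Space K]
    [MeasurableSpace K] [BorelSpace K] {μ ν : Measure K} [IsFiniteMeasure μ] [μ.InnerRegular]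
    (h : ν ≤ μ) : ν.InnerRegular := by
  have hν : IsFiniteMeasure ν := isFiniteMeasure_of_le μ h
  refine ⟨fun A hA r hr => ?_⟩
  obtain ⟨L, hLA, hL, hLμ⟩ := hA.exists_isCompact_sdiff_lt (measure_ne_top μ A)
    (tsub_pos_of_lt hr).ne'
  refine ⟨L, hLA, hL, ?_⟩
  have h1 : ν A ≤ ν L + ν (A \ L) := by
    rw [add_comm]
    simpa [Set.sdiff_union_of_subset hLA] using measure_union_le (μ := ν) (A \ L) L
  by_contra! hcon
  have h2 : ν (A \ L) < ν A - r := (h _).trans_lt hLμ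
  have h3 : r ≠ ∞ := hr.ne_top
  have : ν A < r + (ν A - r) :=
    h1.trans_lt ((add_le_add_left hcon _).trans_lt (ENNReal.add_lt_add_left h3 h2))
  rw [add_tsub_cancel_of_le hr.le] at this
  exact this.false

/-- The values taken by a functional on the order interval `[0, f]`. -/
def intervalValues [CompactSpace K] (φ : C(K, ℝ) →L[ℝ] ℝ) (f : C(K, ℝ)) : Set ℝ :=
  φ '' Set.Icc 0 f

variable [CompactSpace K] (φ : C(K, ℝ) →L[ℝ] ℝ)

theorem intervalValues_nonempty {f : C(K, ℝ)} (hf : 0 ≤ f) : (intervalValues φ f).Nonempty :=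
  ⟨_, 0, ⟨le_rfl, hf⟩, rfl⟩

theorem bddAbove_intervalValues (f : C(K, ℝ)) : BddAbove (intervalValues φ f) := by
  refine ⟨‖φ‖ * ‖f‖, ?_⟩
  rintro _ ⟨h, ⟨h0, hf⟩, rfl⟩
  refine (le_abs_self _).trans ((φ.le_opNorm h).trans ?_)
  gcongr
  refine (ContinuousMap.norm_le _ (norm_nonneg f)).2 fun t => ?_
  have h0' : 0 ≤ h t := h0 t
  rw [Real.norm_of_nonneg h0']
  exact (hf t : h t ≤ f t).trans ((le_abs_self _).trans (f.norm_coe_le_norm t))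

theorem intervalValues_add {f g : C(K, ℝ)} (hf : 0 ≤ f) (hg : 0 ≤ g) :
    intervalValues φ (f + g) = intervalValues φ f + intervalValues φ g := by
  ext r
  constructor
  · rintro ⟨h, ⟨h0, hfg⟩, rfl⟩
    refine ⟨_, ⟨h ⊓ f, ⟨le_inf h0 hf, inf_le_right⟩, rfl⟩, _,
      ⟨h - h ⊓ f, ⟨sub_nonneg.2 inf_le_left, ?_⟩, rfl⟩, by simp⟩
    exact sub_le_comm.1 (le_inf (sub_le_self h hg) (sub_le_iff_le_add.2 hfg))
  · rintro ⟨_, ⟨h, ⟨h0, hf⟩, rfl⟩, _, ⟨k, ⟨k0, kg⟩, rfl⟩, rfl⟩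
    exact ⟨h + k, ⟨add_nonneg h0 k0, add_le_add hf kg⟩, map_add φ h k⟩

theorem intervalValues_smul {c : ℝ} (hc : 0 < c) (f : C(K, ℝ)) :
    intervalValues φ (c • f) = c • intervalValues φ f := by
  ext r
  constructor
  · rintro ⟨h, ⟨h0, hf⟩, rfl⟩
    refine ⟨_, ⟨c⁻¹ • h, ⟨smul_nonneg (by positivity) h0, ?_⟩, rfl⟩, ?_⟩
    · rwa [inv_smul_le_iff_of_pos hc]
    · simp [hc.ne']
  · rintro ⟨_, ⟨h, ⟨h0, hf⟩, rfl⟩, rfl⟩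
    exact ⟨c • h, ⟨smul_nonneg hc.le h0, smul_le_smul_of_nonneg_left hf hc.le⟩, map_smul φ c h⟩

/-- The positive part of a bounded functional, evaluated at a nonnegative function. -/
noncomputable def functionalPosPart (f : C(K, ℝ)) : ℝ := sSup (intervalValues φ f)

theorem functionalPosPart_nonneg {f : C(K, ℝ)} (hf : 0 ≤ f) : 0 ≤ functionalPosPart φ f :=
  le_csSup (bddAbove_intervalValues φ f) ⟨0, ⟨le_rfl, hf⟩, map_zero φ⟩

theorem le_functionalPosPart {f : C(K, ℝ)} (hf : 0 ≤ f) : φ f ≤ functionalPosPart φ f :=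
  le_csSup (bddAbove_intervalValues φ f) ⟨f, ⟨hf, le_rfl⟩, rfl⟩

theorem functionalPosPart_add {f g : C(K, ℝ)} (hf : 0 ≤ f) (hg : 0 ≤ g) :
    functionalPosPart φ (f + g) = functionalPosPart φ f + functionalPosPart φ g := by
  rw [functionalPosPart, intervalValues_add φ hf hg]
  exact csSup_add (intervalValues_nonempty φ hf) (bddAbove_intervalValues φ f)
    (intervalValues_nonempty φ hg) (bddAbove_intervalValues φ g)

theorem functionalPosPart_smul {c : ℝ} (hc : 0 ≤ c) (f : C(K, ℝ)) :
    functionalPosPart φ (c • f) = c * functionalPosPart φ f := by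
  rcases hc.eq_or_lt with rfl | hc
  · simp [functionalPosPart, intervalValues]
  · rw [functionalPosPart, intervalValues_smul φ hc, Real.sSup_smul_of_nonneg hc.le]
    rfl

theorem integral_sub_integral_measure_sub [MeasurableSpace K] [BorelSpace K]
    (μ ν : Measure K) [IsFiniteMeasure μ] [IsFiniteMeasure ν] (f : C(K, ℝ)) :
    ∫ t, f t ∂(μ - ν) - ∫ t, f t ∂(ν - μ) = ∫ t, f t ∂μ - ∫ t, f t ∂ν := by
  have hint : ∀ ρ : Measure K, IsFiniteMeasure ρ → Integrable f ρ := fun ρ _ =>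
    f.continuous.integrable_of_hasCompactSupport (HasCompactSupport.of_compactSpace _)
  have h : (μ - ν) + ν = (ν - μ) + μ := by
    rw [← Measure.toSignedMeasure_eq_toSignedMeasure_iff, Measure.toSignedMeasure_add,
      Measure.toSignedMeasure_add]
    have := Measure.sub_toSignedMeasure_eq_toSignedMeasure_sub (μ := μ) (ν := ν)
    rw [sub_eq_sub_iff_add_eq_add] at this
    rw [← this, add_comm]
  have h1 := congrArg (fun ρ => ∫ t, f t ∂ρ) h
  beta_reduce at h1
  rw [integral_add_measure (hint _ inferInstance) (hint _ inferInstance),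
    integral_add_measure (hint _ inferInstance) (hint _ inferInstance)] at h1
  linarith

variable [T2Space K] [MeasurableSpace K] [BorelSpace K]

/-- A form of the Riesz–Markov–Kakutani theorem for functionals that are only defined on
nonnegative functions. -/
theorem exists_regular_measure_of_additive (p : C(K, ℝ) → ℝ)
    (h0 : ∀ f, 0 ≤ f → 0 ≤ p f)
    (hadd : ∀ f g, 0 ≤ f → 0 ≤ g → p (f + g) = p f + p g)
    (hsmul : ∀ (c : ℝ) f, 0 ≤ c → 0 ≤ f → p (c • f) = c * p f) :
    ∃ μ : Measure K, IsFiniteMeasure μ ∧ μ.Regular ∧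
      ∀ f : C(K, ℝ), 0 ≤ f → ∫ t, f t ∂μ = p f := by
  let toReal : C_c(K, ℝ≥0) → C(K, ℝ) := fun f => ⟨fun t => (f t : ℝ), by fun_prop⟩
  have hpos : ∀ f, 0 ≤ toReal f := fun f t => NNReal.coe_nonneg _
  let Λ : C_c(K, ℝ≥0) →ₗ[ℝ≥0] ℝ≥0 :=
    { toFun := fun f => ⟨p (toReal f), h0 _ (hpos f)⟩
      map_add' := fun f g => NNReal.eq (hadd _ _ (hpos f) (hpos g))
      map_smul' := fun c f => NNReal.eq (hsmul c _ c.2 (hpos f)) }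
  refine ⟨NNRealRMK.rieszMeasure Λ, inferInstance, inferInstance, fun f hf => ?_⟩
  let g : C_c(K, ℝ≥0) :=
    ⟨⟨fun t => (f t).toNNReal, by fun_prop⟩, HasCompactSupport.of_compactSpace _⟩
  have hg : toReal g = f := by
    ext t
    exact Real.coe_toNNReal _ (hf t)
  have h := NNRealRMK.integral_rieszMeasure Λ g
  have h' : ((Λ g : ℝ≥0) : ℝ) = p (toReal g) := rfl
  rw [h', hg] at h
  rw [← h]
  exact integral_congr_ae (.of_forall fun t => (Real.coe_toNNReal _ (hf t)).symm)

/-- The **Riesz–Markov–Kakutani theorem** for bounded functionals on `C(K, ℝ)`. -/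
theorem exists_regular_signedMeasure_integral_eq :
    ∃ μ : SignedMeasure K, μ.totalVariation.Regular ∧ ∀ f : C(K, ℝ),
      φ f = (∫ t, f t ∂μ.toJordanDecomposition.posPart)
        - ∫ t, f t ∂μ.toJordanDecomposition.negPart := by
  obtain ⟨μ, _, _, hμ⟩ := exists_regular_measure_of_additive (functionalPosPart φ)
    (fun f hf => functionalPosPart_nonneg φ hf) (fun f g hf hg => functionalPosPart_add φ hf hg)
    (fun c f hc _ => functionalPosPart_smul φ hc f)
  obtain ⟨ν, _, _, hν⟩ := exists_regular_measure_of_additive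
    (fun f => functionalPosPart φ f - φ f)
    (fun f hf => sub_nonneg.2 (le_functionalPosPart φ hf))
    (fun f g hf hg => by simp only [functionalPosPart_add φ hf hg, map_add]; ring)
    (fun c f hc _ => by simp only [functionalPosPart_smul φ hc, map_smul, smul_eq_mul]; ring)
  refine ⟨μ.toSignedMeasure - ν.toSignedMeasure, ?_, fun f => ?_⟩
  · rw [SignedMeasure.totalVariation, Measure.toJordanDecomposition_toSignedMeasure_sub]
    have := Measure.InnerRegular.of_le_of_isFiniteMeasure (Measure.sub_le (μ := μ) (ν := ν))
    have := Measure.InnerRegular.of_le_of_isFiniteMeasure (Measure.sub_le (μ := ν) (ν := μ))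
    change ((μ - ν) + (ν - μ)).Regular
    infer_instance
  · rw [Measure.toJordanDecomposition_toSignedMeasure_sub]
    change _ = ∫ t, f t ∂(μ - ν) - ∫ t, f t ∂(ν - μ)
    rw [integral_sub_integral_measure_sub]
    have key : ∀ g : C(K, ℝ), 0 ≤ g → φ g = ∫ t, g t ∂μ - ∫ t, g t ∂ν := fun g hg => by
      rw [hμ g hg, hν g hg]; ring
    have hint : ∀ (g : C(K, ℝ)) (ρ : Measure K), IsFiniteMeasure ρ → Integrable g ρ :=
      fun g ρ _ =>
        g.continuous.integrable_of_hasCompactSupport (HasCompactSupport.of_compactSpace _)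
    have h1 := key f⁺ (posPart_nonneg f)
    have h2 := key f⁻ (negPart_nonneg f)
    have h3 : ∀ ρ : Measure K, IsFiniteMeasure ρ →
        ∫ t, f t ∂ρ = ∫ t, f⁺ t ∂ρ - ∫ t, f⁻ t ∂ρ := fun ρ hρ => by
      rw [← integral_sub (hint _ ρ hρ) (hint _ ρ hρ)]
      congr 1 with t
      exact (DFunLike.congr_fun (posPart_sub_negPart f) t).symm
    rw [h3 μ inferInstance, h3 ν inferInstance]
    nth_rewrite 1 [← posPart_sub_negPart f]
    rw [map_sub, h1, h2]
    ring

end Riesz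

section Polarization

variable {ι : Type*} [Fintype ι] [DecidableEq ι]

theorem sum_neg_one_pow_card_mul_eq_zero_of_insert (j : ι) (F : Finset ι → ℝ)
    (hF : ∀ S, j ∉ S → F (insert j S) = F S) : ∑ S, (-1) ^ S.card * F S = 0 := by
  rw [← Finset.powerset_univ, ← Finset.insert_erase (Finset.mem_univ j),
    Finset.sum_powerset_insert (Finset.notMem_erase j _), ← Finset.sum_add_distrib]
  refine Finset.sum_eq_zero fun S hS => ?_
  have hj : j ∉ S := fun h => Finset.notMem_erase j _ (Finset.mem_powerset.1 hS h)
  rw [hF S hj, Finset.card_insert_of_notMem hj]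
  ring

variable {E : Type*} [AddCommGroup E] [Module ℝ E]

/-- The **polarization formula** for multilinear maps. -/
theorem MultilinearMap.sum_perm_eq_sum_neg_one_pow_card
    (A : MultilinearMap ℝ (fun _ : ι => E) ℝ) (z : ι → E) :
    (-1) ^ Fintype.card ι * ∑ σ : Equiv.Perm ι, A (fun i => z (σ i))
      = ∑ S : Finset ι, (-1) ^ S.card * A (fun _ => ∑ i ∈ S, z i) := by
  have h1 : ∀ S : Finset ι, A (fun _ => ∑ i ∈ S, z i)
      = ∑ f : ι → ι, if ∀ i, f i ∈ S then A (fun i => z (f i)) else 0 := fun S => by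
    rw [A.map_sum_finset (fun _ i => z i) (fun _ => S), ← Finset.sum_filter]
    refine Finset.sum_congr ?_ fun _ _ => rfl
    ext f
    simp [Fintype.mem_piFinset]
  have h2 : ∀ f : ι → ι, ∑ S : Finset ι, (-1) ^ S.card *
      (if ∀ i, f i ∈ S then A (fun i => z (f i)) else 0)
      = if Function.Bijective f then (-1) ^ Fintype.card ι * A (fun i => z (f i)) else 0 := by
    intro f
    split_ifs with hf
    · rw [Finset.sum_eq_single Finset.univ]
      · simp
      · intro S _ hS
        rw [if_neg, mul_zero]
        intro h
        refine hS (Finset.eq_univ_of_forall fun i => ?_)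
        obtain ⟨k, rfl⟩ := hf.2 i
        exact h k
      · simp
    · have hs : ¬ Function.Surjective f := fun h => hf (Finite.surjective_iff_bijective.1 h)
      simp only [Function.Surjective, not_forall, not_exists] at hs
      obtain ⟨j, hj⟩ := hs
      refine sum_neg_one_pow_card_mul_eq_zero_of_insert j _ fun S _ => ?_
      simp [hj]
  simp_rw [h1, Finset.mul_sum]
  rw [Finset.sum_comm]
  simp_rw [← Finset.mul_sum, h2]
  rw [← Finset.sum_filter, Finset.mul_sum]
  refine Finset.sum_bij (fun σ _ => ⇑σ) (fun σ _ => by simp)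
    (fun σ _ τ _ h => DFunLike.coe_injective h) (fun f hf => ?_) fun _ _ => rfl
  exact ⟨Equiv.ofBijective f (Finset.mem_filter.1 hf).2, Finset.mem_univ _, rfl⟩

end Polarization

section Separation

variable {K ι : Type*} [TopologicalSpace K] [Fintype ι] [DecidableEq ι]

/-- The symmetrization of `A` vanishes when its arguments split into two nonempty groups that are
orthogonal to each other. -/
theorem sum_perm_eq_zero_of_mul_eq_zero (A : MultilinearMap ℝ (fun _ : ι => C(K, ℝ)) ℝ)
    (hA : ∀ x y : C(K, ℝ), x * y = 0 →
      A (fun _ => x + y) = A (fun _ => x) + A (fun _ => y))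
    (L : Set ι) (z : ι → C(K, ℝ)) (hL : L.Nonempty) (hLc : Lᶜ.Nonempty)
    (hz : ∀ i ∈ L, ∀ j ∉ L, z i * z j = 0) :
    ∑ σ : Equiv.Perm ι, A (fun i => z (σ i)) = 0 := by
  classical
  obtain ⟨l, hl⟩ := hL
  obtain ⟨r, hr⟩ := hLc
  have key : ∑ S : Finset ι, (-1) ^ S.card * A (fun _ => ∑ i ∈ S, z i) = 0 := by
    have h : ∀ S : Finset ι, A (fun _ => ∑ i ∈ S, z i)
        = A (fun _ => ∑ i ∈ S with i ∈ L, z i) + A (fun _ => ∑ i ∈ S with i ∉ L, z i) := by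
      intro S
      rw [← hA, Finset.sum_filter_add_sum_filter_not]
      rw [Finset.sum_mul_sum]
      refine Finset.sum_eq_zero fun i hi => Finset.sum_eq_zero fun j hj => ?_
      exact hz i (Finset.mem_filter.1 hi).2 j (Finset.mem_filter.1 hj).2
    rw [Finset.sum_congr rfl fun S _ => congrArg ((-1) ^ S.card * ·) (h S)]
    simp only [mul_add, Finset.sum_add_distrib]
    rw [sum_neg_one_pow_card_mul_eq_zero_of_insert r
        (fun S => A (fun _ => ∑ i ∈ S with i ∈ L, z i)),
      sum_neg_one_pow_card_mul_eq_zero_of_insert l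
        (fun S => A (fun _ => ∑ i ∈ S with i ∉ L, z i)), add_zero]
    · intro S _
      rw [Finset.filter_insert, if_neg (not_not.2 hl)]
    · intro S _
      rw [Finset.filter_insert, if_neg hr]
  rw [← MultilinearMap.sum_perm_eq_sum_neg_one_pow_card] at key
  exact (mul_eq_zero.1 key).resolve_left (pow_ne_zero _ (by norm_num))

/-- The function `w - a` truncated to the interval `[0, 1]`. -/
def unitStep (w : C(K, ℝ)) (a : ℝ) : C(K, ℝ) :=
  ⟨fun t => max 0 (min 1 (w t - a)), by fun_prop⟩

theorem unitStep_apply (w : C(K, ℝ)) (a : ℝ) (t : K) :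
    unitStep w a t = max 0 (min 1 (w t - a)) := rfl

theorem unitStep_nonneg (w : C(K, ℝ)) (a : ℝ) (t : K) : 0 ≤ unitStep w a t := le_max_left _ _

theorem unitStep_le_one (w : C(K, ℝ)) (a : ℝ) (t : K) : unitStep w a t ≤ 1 :=
  max_le zero_le_one (min_le_left _ _)

theorem unitStep_eq_zero {w : C(K, ℝ)} {a : ℝ} {t : K} (h : w t ≤ a) : unitStep w a t = 0 :=
  max_eq_left ((min_le_right _ _).trans (sub_nonpos.2 h))

theorem unitStep_eq_one {w : C(K, ℝ)} {a : ℝ} {t : K} (h : a + 1 ≤ w t) :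
    unitStep w a t = 1 := by
  rw [unitStep_apply, min_eq_left (by linarith), max_eq_right zero_le_one]

theorem unitStep_anti (w : C(K, ℝ)) {a b : ℝ} (h : a ≤ b) (t : K) :
    unitStep w b t ≤ unitStep w a t :=
  max_le_max_left _ (min_le_min_left _ (by linarith))

theorem sum_range_unitStep_apply {w : C(K, ℝ)} {t : K} (h : 0 ≤ w t) (m : ℕ) :
    ∑ i ∈ Finset.range m, unitStep w i t = min (w t) m := by
  induction m with
  | zero => simp [h]
  | succ m ih =>
    rw [Finset.sum_range_succ, ih]
    push_cast
    rcases le_total (w t) m with h1 | h1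
    · rw [unitStep_eq_zero h1, min_eq_left h1, min_eq_left (by linarith), add_zero]
    · rcases le_total (w t) (m + 1) with h2 | h2
      · rw [unitStep_apply, min_eq_right h1, min_eq_left h2, min_eq_right (by linarith),
          max_eq_right (by linarith)]
        ring
      · rw [unitStep_eq_one h2, min_eq_right h1, min_eq_right h2]

theorem map_eq_zero_of_separated {ι : Type*} [DecidableEq ι]
    {M : MultilinearMap ℝ (fun _ : ι => C(K, ℝ)) ℝ}
    (hM : ∀ (L : Set ι) (z : ι → C(K, ℝ)), L.Nonempty → Lᶜ.Nonempty →
      (∀ i ∈ L, ∀ j ∉ L, z i * z j = 0) → M z = 0)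
    (w : C(K, ℝ)) (S : Finset ι) : ∀ (α β : ℝ) (z : ι → C(K, ℝ)), α < β →
      (∃ i ∉ S, ∀ t, α < w t → z i t = 0) → (∃ i ∉ S, ∀ t, w t < β → z i t = 0) →
      (∀ i ∉ S, (∀ t, α < w t → z i t = 0) ∨ (∀ t, w t < β → z i t = 0)) → M z = 0 := by
  induction S using Finset.induction with
  | empty =>
    rintro α β z hαβ ⟨l, -, hl⟩ ⟨r, -, hr⟩ hz
    by_cases hrl : ∀ t, α < w t → z r t = 0
    · refine M.map_coord_zero r ?_
      ext t
      rcases lt_or_ge α (w t) with h | h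
      · exact hrl t h
      · exact hr t (h.trans_lt hαβ)
    · refine hM {i | ∀ t, α < w t → z i t = 0} z ⟨l, hl⟩ ⟨r, hrl⟩ fun i hi j hj => ?_
      ext t
      rcases lt_or_ge α (w t) with h | h
      · simp [hi t h]
      · simp [((hz j (by simp)).resolve_left hj) t (h.trans_lt hαβ)]
  | insert a S ha ih =>
    rintro α β z hαβ ⟨l, hlS, hl⟩ ⟨r, hrS, hr⟩ hz
    obtain ⟨γ, hαγ, hγβ⟩ := exists_between hαβ
    obtain ⟨δ, hγδ, hδβ⟩ := exists_between hγβ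
    have hd : 0 < δ - γ := sub_pos.2 hγδ
    set c : C(K, ℝ) := unitStep ((δ - γ)⁻¹ • (w - ContinuousMap.const K γ)) 0 with hc
    have hc0 : ∀ t, w t < γ → c t = 0 := fun t ht => by
      refine unitStep_eq_zero ?_
      change (δ - γ)⁻¹ * (w t - γ) ≤ 0
      exact mul_nonpos_of_nonneg_of_nonpos (by positivity) (by linarith)
    have hc1 : ∀ t, δ < w t → c t = 1 := fun t ht => by
      refine unitStep_eq_one ?_
      change 0 + 1 ≤ (δ - γ)⁻¹ * (w t - γ)
      rw [zero_add, inv_mul_eq_div, one_le_div hd]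
      linarith
    rw [Finset.mem_insert, not_or] at hlS hrS
    have hsplit : z = Function.update z a (z a * (1 - c) + z a * c) := by
      rw [← mul_add, sub_add_cancel, mul_one, Function.update_eq_self]
    rw [hsplit, M.map_update_add, ih δ β, ih α γ, add_zero]
    · exact hαγ
    · exact ⟨l, hlS.2, by rwa [Function.update_of_ne hlS.1]⟩
    · refine ⟨r, hrS.2, ?_⟩
      rw [Function.update_of_ne hrS.1]
      exact fun t ht => hr t (ht.trans hγβ)
    · intro i hi
      rcases eq_or_ne i a with rfl | hia
      · exact Or.inr fun t ht => by simp [hc0 t ht]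
      · rw [Function.update_of_ne hia]
        exact (hz i (by simp [hia, hi])).imp_right fun h t ht => h t (ht.trans hγβ)
    · exact hδβ
    · refine ⟨l, hlS.2, ?_⟩
      rw [Function.update_of_ne hlS.1]
      exact fun t ht => hl t ((hαγ.trans hγδ).trans ht)
    · exact ⟨r, hrS.2, by rwa [Function.update_of_ne hrS.1]⟩
    · intro i hi
      rcases eq_or_ne i a with rfl | hia
      · exact Or.inl fun t ht => by simp [hc1 t ht]
      · rw [Function.update_of_ne hia]
        exact (hz i (by simp [hia, hi])).imp_left fun h t ht => h t ((hαγ.trans hγδ).trans ht)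

end Separation

section Approximation

variable {K ι : Type*} [TopologicalSpace K] [CompactSpace K] [Fintype ι] [DecidableEq ι]

theorem ContinuousMultilinearMap.map_eq_zero_of_mul_eq_zero
    {M : ContinuousMultilinearMap ℝ (fun _ : ι => C(K, ℝ)) ℝ}
    (hM : ∀ (L : Set ι) (z : ι → C(K, ℝ)), L.Nonempty → Lᶜ.Nonempty →
      (∀ i ∈ L, ∀ j ∉ L, z i * z j = 0) → M z = 0)
    {z : ι → C(K, ℝ)} {i j : ι} (hij : i ≠ j) (hz : z i * z j = 0) : M z = 0 := by
  set φ := M.toContinuousLinearMap z i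
  have hφ : ∀ ε > 0, ‖φ (z i)‖ ≤ ‖φ‖ * ε := by
    intro ε hε
    let y : C(K, ℝ) := ⟨fun t => max (-ε) (min ε (z i t)), by fun_prop⟩
    have hy : ‖y‖ ≤ ε := (ContinuousMap.norm_le _ hε.le).2 fun t =>
      abs_le.2 ⟨le_max_left _ _, max_le (by linarith) (min_le_left _ _)⟩
    have h0 : φ (z i - y) = 0 := by
      refine map_eq_zero_of_separated (M := M.toMultilinearMap) hM |z i| (Finset.univ \ {i, j})
        0 ε _ hε ⟨j, by simp, ?_⟩ ⟨i, by simp, ?_⟩ ?_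
      all_goals
        have hj : ∀ t, 0 < |z i| t → Function.update z i (z i - y) j t = 0 := by
          intro t ht
          rw [Function.update_of_ne hij.symm]
          have := DFunLike.congr_fun hz t
          exact (mul_eq_zero.1 this).resolve_left (abs_pos.1 ht)
        have hi : ∀ t, |z i| t < ε → Function.update z i (z i - y) i t = 0 := by
          intro t ht
          rw [Function.update_self]
          have h := abs_lt.1 (show |z i t| < ε from ht)
          change z i t - max (-ε) (min ε (z i t)) = 0
          rw [min_eq_right h.2.le, max_eq_right h.1.le, sub_self]
      · exact hj
      · exact hi
      · intro k hk
        have : k = i ∨ k = j := by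
          by_contra! h
          simp [h] at hk
        rcases this with rfl | rfl
        · exact Or.inr hi
        · exact Or.inl hj
    rw [map_sub, sub_eq_zero] at h0
    rw [h0]
    exact (φ.le_opNorm y).trans (by gcongr)
  have h : φ (z i) = M z := by
    change M (Function.update z i (z i)) = M z
    rw [Function.update_eq_self]
  rw [← h, ← norm_le_zero_iff]
  have hlim : Filter.Tendsto (fun ε : ℝ => ‖φ‖ * ε) (nhdsWithin 0 (Set.Ioi 0)) (nhds 0) := by
    have : Filter.Tendsto (fun ε : ℝ => ‖φ‖ * ε) (nhds 0) (nhds (‖φ‖ * 0)) :=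
      (continuous_const.mul continuous_id).tendsto 0
    rw [mul_zero] at this
    exact this.mono_left nhdsWithin_le_nhds
  exact ge_of_tendsto hlim (by filter_upwards [self_mem_nhdsWithin] with ε hε using hφ ε hε)

variable {D : C(K, ℝ) →ₗ[ℝ] C(K, ℝ) →ₗ[ℝ] ℝ} {C : ℝ}

theorem norm_sum_le_one_of_telescope {m : ℕ} {u v : ℕ → C(K, ℝ)}
    (hu : ∀ a t, u a t ≤ 1) (hu0 : ∀ a t, 0 ≤ u a t)
    (hvu : ∀ a t, v a t ≤ u a t) (huv : ∀ a t, u (a + 1) t ≤ v a t) :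
    ‖∑ a ∈ Finset.range m, (u a - v a)‖ ≤ 1 := by
  refine (ContinuousMap.norm_le _ zero_le_one).2 fun t => ?_
  have h : ∑ a ∈ Finset.range m, (u a - v a) t ≤ 1 - u m t := by
    induction m with
    | zero => simpa using hu 0 t
    | succ m ih =>
      rw [Finset.sum_range_succ, ContinuousMap.sub_apply]
      linarith [huv m t]
  have h0 : 0 ≤ ∑ a ∈ Finset.range m, (u a - v a) t :=
    Finset.sum_nonneg fun a _ => sub_nonneg.2 (hvu a t)
  rw [ContinuousMap.sum_apply, Real.norm_of_nonneg h0]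
  linarith [hu0 m t]

theorem abs_map_sum_unitStep_le
    (hD : ∀ (f g : C(K, ℝ)) (c : ℝ), f * (g - c • 1) = 0 → D f g = 0)
    (hC : 0 ≤ C) (hDC : ∀ f g, |D f g| ≤ C * ‖f‖ * ‖g‖) (f w : C(K, ℝ)) (b : ℝ) (m : ℕ) :
    |D f (∑ a ∈ Finset.range m, unitStep w (b + 4 * a))| ≤ C * ‖f‖ := by
  have hD0 : ∀ f g : C(K, ℝ), f * g = 0 → D f g = 0 := fun f g h => hD f g 0 (by simpa using h)
  set e : ℕ → C(K, ℝ) := fun a => unitStep w (b + 4 * a - 1) - unitStep w (b + 4 * a + 1)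
    with he
  set p : ℕ → C(K, ℝ) := fun a => unitStep w (b + 4 * a) - unitStep w (b + 4 * a + 2) with hp
  have hep : ∀ a a', a ≠ a' → e a * p a' = 0 := by
    intro a a' h
    ext t
    simp only [he, hp, ContinuousMap.mul_apply, ContinuousMap.sub_apply,
      ContinuousMap.zero_apply]
    rcases h.lt_or_gt with h | h
    · have h' : (a : ℝ) + 1 ≤ a' := by exact_mod_cast h
      rcases le_total (w t) (b + 4 * a') with h1 | h1
      · rw [unitStep_eq_zero (a := b + 4 * a') h1, unitStep_eq_zero (a := b + 4 * a' + 2)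
          (by linarith), sub_zero, mul_zero]
      · rw [unitStep_eq_one (a := b + 4 * a - 1) (by linarith),
          unitStep_eq_one (a := b + 4 * a + 1) (by linarith), sub_self, zero_mul]
    · have h' : (a' : ℝ) + 1 ≤ a := by exact_mod_cast h
      rcases le_total (w t) (b + 4 * a - 1) with h1 | h1
      · rw [unitStep_eq_zero (a := b + 4 * a - 1) h1, unitStep_eq_zero (a := b + 4 * a + 1)
          (by linarith), sub_zero, zero_mul]
      · rw [unitStep_eq_one (a := b + 4 * a') (by linarith),
          unitStep_eq_one (a := b + 4 * a' + 2) (by linarith), sub_self, mul_zero]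
  have hloc : ∀ a : ℕ, D f (unitStep w (b + 4 * a)) = D (f * e a) (p a) := by
    intro a
    have h1 : D (f * (1 - unitStep w (b + 4 * a - 1))) (unitStep w (b + 4 * a)) = 0 := by
      refine hD0 _ _ ?_
      ext t
      simp only [ContinuousMap.mul_apply, ContinuousMap.sub_apply, ContinuousMap.zero_apply,
        ContinuousMap.one_apply]
      rcases le_total (w t) (b + 4 * a) with h | h
      · rw [unitStep_eq_zero h, mul_zero]
      · rw [unitStep_eq_one (a := b + 4 * a - 1) (by linarith), sub_self, mul_zero, zero_mul]
    have h2 : D (f * unitStep w (b + 4 * a + 1)) (unitStep w (b + 4 * a)) = 0 := by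
      refine hD _ _ 1 ?_
      ext t
      simp only [ContinuousMap.mul_apply, ContinuousMap.sub_apply, ContinuousMap.zero_apply,
        ContinuousMap.one_apply, one_smul]
      rcases le_total (w t) (b + 4 * a + 1) with h | h
      · rw [unitStep_eq_zero h, mul_zero, zero_mul]
      · rw [unitStep_eq_one (a := b + 4 * a) (by linarith), sub_self, mul_zero]
    have h3 : D (f * e a) (unitStep w (b + 4 * a + 2)) = 0 := by
      refine hD0 _ _ ?_
      ext t
      simp only [he, ContinuousMap.mul_apply, ContinuousMap.sub_apply, ContinuousMap.zero_apply]
      rcases le_total (w t) (b + 4 * a + 2) with h | h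
      · rw [unitStep_eq_zero h, mul_zero]
      · rw [unitStep_eq_one (a := b + 4 * a - 1) (by linarith),
          unitStep_eq_one (a := b + 4 * a + 1) (by linarith), sub_self, mul_zero, zero_mul]
    have hf : f = f * (1 - unitStep w (b + 4 * a - 1)) + f * e a
        + f * unitStep w (b + 4 * a + 1) := by
      simp only [he]; ring
    rw [hp, map_sub, h3, sub_zero]
    nth_rewrite 1 [hf]
    rw [map_add, map_add, LinearMap.add_apply, LinearMap.add_apply, h1, h2, zero_add, add_zero]
  have hsum : D f (∑ a ∈ Finset.range m, unitStep w (b + 4 * a))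
      = D (f * ∑ a ∈ Finset.range m, e a) (∑ a ∈ Finset.range m, p a) := by
    rw [Finset.mul_sum, map_sum, map_sum]
    refine Finset.sum_congr rfl fun a ha => ?_
    rw [hloc, map_sum, LinearMap.sum_apply, Finset.sum_eq_single a]
    · intro a' _ h
      exact hD0 _ _ (by rw [mul_assoc, hep a' a h, mul_zero])
    · exact fun h => absurd ha h
  have he1 : ‖∑ a ∈ Finset.range m, e a‖ ≤ 1 :=
    norm_sum_le_one_of_telescope (fun a => unitStep_le_one _ _) (fun a => unitStep_nonneg _ _)
      (fun a => unitStep_anti _ (by linarith))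
      (fun a => unitStep_anti _ (by push_cast; linarith))
  have hp1 : ‖∑ a ∈ Finset.range m, p a‖ ≤ 1 :=
    norm_sum_le_one_of_telescope (fun a => unitStep_le_one _ _) (fun a => unitStep_nonneg _ _)
      (fun a => unitStep_anti _ (by linarith))
      (fun a => unitStep_anti _ (by push_cast; linarith))
  rw [hsum]
  calc _ ≤ C * ‖f * ∑ a ∈ Finset.range m, e a‖ * ‖∑ a ∈ Finset.range m, p a‖ := hDC _ _
    _ ≤ C * (‖f‖ * 1) * 1 := by
      gcongr
      exact (norm_mul_le _ _).trans (by gcongr)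
    _ = C * ‖f‖ := by ring

/-- A bounded bilinear form `D` on `C(K, ℝ)` such that `D f g = 0` whenever `g` is constant on the
set where `f` does not vanish is zero. -/
theorem bilinear_eq_zero_of_local
    (hD : ∀ (f g : C(K, ℝ)) (c : ℝ), f * (g - c • 1) = 0 → D f g = 0)
    (hC : 0 ≤ C) (hDC : ∀ f g, |D f g| ≤ C * ‖f‖ * ‖g‖) (f g : C(K, ℝ)) : D f g = 0 := by
  have hsplit : ∀ (F : ℕ → C(K, ℝ)) (m : ℕ), ∑ i ∈ Finset.range (4 * m), F i
      = ∑ a ∈ Finset.range m, F (0 + 4 * a) + ∑ a ∈ Finset.range m, F (1 + 4 * a)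
        + ∑ a ∈ Finset.range m, F (2 + 4 * a) + ∑ a ∈ Finset.range m, F (3 + 4 * a) := by
    intro F m
    induction m with
    | zero => simp
    | succ m ih =>
      have h1 : 4 * m + 1 = 1 + 4 * m := add_comm _ _
      have h2 : 4 * m + 1 + 1 = 2 + 4 * m := by ring
      have h3 : 4 * m + 1 + 1 + 1 = 3 + 4 * m := by ring
      rw [show 4 * (m + 1) = 4 * m + 1 + 1 + 1 + 1 by ring]
      simp only [Finset.sum_range_succ, ih, zero_add]
      rw [h3, h2, h1]
      abel
  set g' : C(K, ℝ) := g + ‖g‖ • 1 with hg'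
  have hgg' : D f g' = D f g := by
    rw [hg', map_add, map_smul, hD f 1 1 (by simp), smul_zero, add_zero]
  have hg0 : ∀ t, 0 ≤ g' t := fun t => by
    have := neg_le_of_abs_le (g.norm_coe_le_norm t)
    simp only [hg', ContinuousMap.add_apply, ContinuousMap.smul_apply, ContinuousMap.one_apply,
      smul_eq_mul, mul_one]
    linarith
  have hbound : ∀ N : ℕ, N * |D f g'| ≤ 4 * (C * ‖f‖) := by
    intro N
    set w : C(K, ℝ) := (N : ℝ) • g' with hw
    obtain ⟨m, hm⟩ := exists_nat_ge ‖w‖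
    have hws : w = ∑ i ∈ Finset.range (4 * m), unitStep w i := by
      ext t
      have hwt : 0 ≤ w t := mul_nonneg (Nat.cast_nonneg N) (hg0 t)
      rw [ContinuousMap.sum_apply, sum_range_unitStep_apply hwt, min_eq_left]
      have := (le_abs_self _).trans (w.norm_coe_le_norm t)
      push_cast
      linarith [(Nat.cast_nonneg m : (0 : ℝ) ≤ m)]
    have hN : N * |D f g'| = |D f w| := by
      rw [hw, map_smul, smul_eq_mul, abs_mul, Nat.abs_cast]
    have key := abs_map_sum_unitStep_le hD hC hDC f w
    rw [hN]
    nth_rewrite 1 [hws]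
    rw [hsplit (fun i => unitStep w i)]
    push_cast
    rw [map_add, map_add, map_add]
    have k0 := key 0 m
    have k1 := key 1 m
    have k2 := key 2 m
    have k3 := key 3 m
    rw [abs_le] at *
    constructor <;> linarith [k0.1, k0.2, k1.1, k1.2, k2.1, k2.2, k3.1, k3.2]
  rw [← hgg']
  by_contra hne
  obtain ⟨N, hN⟩ := exists_nat_gt (4 * (C * ‖f‖) / |D f g'|)
  rw [div_lt_iff₀ (abs_pos.2 hne)] at hN
  exact (hbound N).not_gt hN

/-- A bounded bilinear form on `C(K, ℝ)` that vanishes on orthogonal pairs factors through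
multiplication. -/
theorem bilinear_apply_eq_mul_one {B : C(K, ℝ) →ₗ[ℝ] C(K, ℝ) →ₗ[ℝ] ℝ}
    (hB : ∀ f g, f * g = 0 → B f g = 0) (hC : 0 ≤ C)
    (hBC : ∀ f g, |B f g| ≤ C * ‖f‖ * ‖g‖) (f g : C(K, ℝ)) : B f g = B (f * g) 1 := by
  have h := bilinear_eq_zero_of_local
    (D := B - (LinearMap.mul ℝ C(K, ℝ)).compr₂ (B.flip 1)) (C := 2 * C) ?_ (by positivity) ?_ f g
  · simpa [sub_eq_zero] using h
  · intro f g c h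
    have h1 := hB _ _ h
    rw [mul_sub, sub_eq_zero] at h
    rw [map_sub, sub_eq_zero] at h1
    simp [h, h1]
  · intro f g
    have hone : ‖(1 : C(K, ℝ))‖ ≤ 1 :=
      (ContinuousMap.norm_le _ zero_le_one).2 fun t => by simp
    have h1 := hBC f g
    have h2 : |B (f * g) 1| ≤ C * ‖f‖ * ‖g‖ := by
      calc _ ≤ C * ‖f * g‖ * ‖(1 : C(K, ℝ))‖ := hBC _ _
        _ ≤ C * (‖f‖ * ‖g‖) * 1 := by
          gcongr
          exact norm_mul_le f g
        _ = C * ‖f‖ * ‖g‖ := by ring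
    calc _ = |B f g - B (f * g) 1| := by simp
      _ ≤ |B f g| + |B (f * g) 1| := abs_sub _ _
      _ ≤ _ := by linarith

theorem ContinuousMultilinearMap.map_update_update_mul
    {M : ContinuousMultilinearMap ℝ (fun _ : ι => C(K, ℝ)) ℝ} {i j : ι} (hij : i ≠ j)
    (hM : ∀ z : ι → C(K, ℝ), z i * z j = 0 → M z = 0) (z : ι → C(K, ℝ)) (f g : C(K, ℝ)) :
    M (Function.update (Function.update z i f) j g)
      = M (Function.update (Function.update z i (f * g)) j 1) := by
  let B : C(K, ℝ) →ₗ[ℝ] C(K, ℝ) →ₗ[ℝ] ℝ := LinearMap.mk₂ ℝ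
    (fun f g => M (Function.update (Function.update z i f) j g))
    (fun f f' g => by simp only [Function.update_comm hij, M.map_update_add])
    (fun c f g => by simp only [Function.update_comm hij, M.map_update_smul])
    (fun f g g' => by simp only [M.map_update_add])
    (fun c f g => by simp only [M.map_update_smul])
  refine bilinear_apply_eq_mul_one (B := B)
    (C := ‖M‖ * ∏ k ∈ (Finset.univ \ {j}) \ {i}, ‖z k‖) (fun f g h => hM _ ?_) (by positivity)
    (fun f g => (M.le_opNorm _).trans_eq ?_) f g
  · simpa [hij] using h
  · have h : ∀ k, ‖Function.update (Function.update z i f) j g k‖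
        = Function.update (Function.update (fun k => ‖z k‖) i ‖f‖) j ‖g‖ k := by
      intro k
      rcases eq_or_ne k j with rfl | hj
      · simp
      · rcases eq_or_ne k i with rfl | hi
        · simp [hj]
        · simp [hj, hi]
    simp_rw [h]
    rw [Finset.prod_update_of_mem (Finset.mem_univ j), Finset.prod_update_of_mem (by simp [hij])]
    ring

theorem ContinuousMultilinearMap.map_const_eq_map_update_one_pow
    {M : ContinuousMultilinearMap ℝ (fun _ : ι => C(K, ℝ)) ℝ}
    (hM : ∀ (i j : ι) (z : ι → C(K, ℝ)), i ≠ j → z i * z j = 0 → M z = 0)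
    (i : ι) (x : C(K, ℝ)) :
    M (fun _ => x) = M (Function.update 1 i (x ^ Fintype.card ι)) := by
  have key : ∀ T : Finset ι, i ∉ T → M (fun _ => x)
      = M (Function.update (fun k => if k ∈ T then 1 else x) i (x ^ (T.card + 1))) := by
    intro T
    induction T using Finset.induction with
    | empty => intro _; simp
    | insert j T hj ih =>
      intro hi
      rw [Finset.mem_insert, not_or] at hi
      rw [ih hi.2]
      have h := ContinuousMultilinearMap.map_update_update_mul hi.1 (fun z => hM i j z hi.1)
        (fun k => if k ∈ T then 1 else x) (x ^ (T.card + 1)) x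
      rw [← pow_succ] at h
      rw [Finset.card_insert_of_notMem hj]
      convert h using 2
      · symm
        rw [Function.update_eq_self_iff, Function.update_of_ne (Ne.symm hi.1), if_neg hj]
      · rw [Function.update_comm hi.1]
        congr 1
        ext k : 1
        rcases eq_or_ne k j with rfl | hk
        · simp
        · simp [hk]
  rw [key (Finset.univ.erase i) (Finset.notMem_erase _ _)]
  congr 1
  ext k : 1
  rcases eq_or_ne k i with rfl | hk
  · simp [Finset.card_erase_of_mem, Nat.sub_add_cancel (Fintype.card_pos_iff.2 ⟨k⟩)]
  · simp [hk]

end Approximation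

theorem ContinuousMap.abs_inf_abs_eq_zero_of_mul_eq_zero {K : Type*} [TopologicalSpace K]
    {x y : C(K, ℝ)} (h : x * y = 0) : |x| ⊓ |y| = 0 := by
  ext t
  change min |x t| |y t| = 0
  rcases mul_eq_zero.1 (DFunLike.congr_fun h t : x t * y t = 0) with h | h <;> simp [h]

/-- **Integral representation of orthogonally additive n-homogeneous polynomials on C(K).**
For every orthogonally additive continuous `n`-homogeneous polynomial `P` on `C(K)`
(`K` compact Hausdorff) there is a regular Borel signed measure `μ` on `K` such that
`P x = ∫ x^n dμ` for all `x ∈ C(K)`. -/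
theorem orthogonally_additive_integral_representation
    {K : Type*} [TopologicalSpace K] [CompactSpace K] [T2Space K]
    [MeasurableSpace K] [BorelSpace K]
    (n : ℕ) (hn : 0 < n) (P : C(K, ℝ) → ℝ)
    (A : ContinuousMultilinearMap ℝ (fun _ : Fin n => C(K, ℝ)) ℝ)
    (hPA : ∀ x : C(K, ℝ), P x = A (fun _ => x))
    (hOA : ∀ x y : C(K, ℝ), |x| ⊓ |y| = 0 → P (x + y) = P x + P y) :
    ∃ μ : SignedMeasure K, μ.totalVariation.Regular ∧
      ∀ x : C(K, ℝ),
        P x = (∫ t, (x t) ^ n ∂μ.toJordanDecomposition.posPart)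
              - ∫ t, (x t) ^ n ∂μ.toJordanDecomposition.negPart := by
  have hA : ∀ x y : C(K, ℝ), x * y = 0 →
      A (fun _ => x + y) = A (fun _ => x) + A (fun _ => y) := fun x y h => by
    simpa only [hPA] using hOA x y (ContinuousMap.abs_inf_abs_eq_zero_of_mul_eq_zero h)
  let M : ContinuousMultilinearMap ℝ (fun _ : Fin n => C(K, ℝ)) ℝ :=
    ∑ σ : Equiv.Perm (Fin n), A.domDomCongr σ
  have hM : ∀ z, M z = ∑ σ : Equiv.Perm (Fin n), A (fun i => z (σ i)) := fun z => by
    simp [M]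
  have hM0 : ∀ (i j : Fin n) (z : Fin n → C(K, ℝ)), i ≠ j → z i * z j = 0 → M z = 0 := by
    intro i j z hij hz
    refine ContinuousMultilinearMap.map_eq_zero_of_mul_eq_zero (fun L z hL hLc h => ?_) hij hz
    rw [hM]
    exact sum_perm_eq_zero_of_mul_eq_zero A.toMultilinearMap hA L z hL hLc h
  have hfac : (n.factorial : ℝ) ≠ 0 := Nat.cast_ne_zero.2 n.factorial_ne_zero
  let i : Fin n := ⟨0, hn⟩
  obtain ⟨μ, hμ, hμφ⟩ := exists_regular_signedMeasure_integral_eq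
    ((n.factorial : ℝ)⁻¹ • M.toContinuousLinearMap 1 i)
  refine ⟨μ, hμ, fun x => ?_⟩
  have h := hμφ (x ^ n)
  simp only [ContinuousMap.pow_apply] at h
  rw [← h]
  have hx := ContinuousMultilinearMap.map_const_eq_map_update_one_pow hM0 i x
  rw [Fintype.card_fin] at hx
  change P x = (n.factorial : ℝ)⁻¹ * M (Function.update 1 i (x ^ n))
  rw [← hx, hM, hPA]
  simp [Fintype.card_perm, hfac]
end

section
/- Let (Ω, Σ, μ) be a finite measure space with μ nonatomic. If P : L¹(μ) → ℝ is a continuous 2-homogeneous polynomial (P(f) = A(f,f) for a continuous bilinear form A) that is orthogonally additive, then P is identically zero. -/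
open MeasureTheory

/-- A set of positive measure for a finite nonatomic measure contains sets of arbitrarily small
positive measure. -/
theorem exists_subset_measure_pos_lt_of_nonatomic {Ω : Type*} [MeasurableSpace Ω]
    {m : Measure Ω} [IsFiniteMeasure m]
    (hna : ∀ s : Set Ω, MeasurableSet s → 0 < m s →
      ∃ t ⊆ s, MeasurableSet t ∧ 0 < m t ∧ m t < m s)
    {s : Set Ω} (hs : MeasurableSet s) (hpos : 0 < m s) {ε : ℝ} (hε : 0 < ε) :
    ∃ t ⊆ s, MeasurableSet t ∧ 0 < m.real t ∧ m.real t < ε := by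
  have hreal (t : Set Ω) : 0 < m t ↔ 0 < m.real t := by
    simp [measureReal_def, ENNReal.toReal_pos_iff]
  have key (n : ℕ) : ∃ t ⊆ s, MeasurableSet t ∧ 0 < m t ∧
      m.real t ≤ m.real s * (1 / 2) ^ n := by
    induction n with
    | zero => exact ⟨s, subset_rfl, hs, hpos, by simp⟩
    | succ n ih =>
      obtain ⟨t, hts, ht, htpos, hle⟩ := ih
      obtain ⟨u, hut, hu, hupos, hlt⟩ := hna t ht htpos
      have hdiff : m.real (t \ u) = m.real t - m.real u := measureReal_sdiff hut hu
      have hlt' : m.real u < m.real t :=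
        (ENNReal.toReal_lt_toReal (measure_ne_top _ _) (measure_ne_top _ _)).2 hlt
      rw [pow_succ]
      rcases le_total (m.real u) (m.real t / 2) with h | h
      · exact ⟨u, hut.trans hts, hu, hupos, by linarith⟩
      · exact ⟨t \ u, Set.sdiff_subset.trans hts, ht.diff hu, (hreal _).2 (by linarith),
          by linarith⟩
  obtain ⟨n, hn⟩ := exists_pow_lt_of_lt_one (div_pos hε ((hreal s).1 hpos))
    (by norm_num : (1 / 2 : ℝ) < 1)
  obtain ⟨t, hts, ht, htpos, hle⟩ := key n
  refine ⟨t, hts, ht, (hreal t).1 htpos, hle.trans_lt ?_⟩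
  rwa [lt_div_iff₀' ((hreal s).1 hpos)] at hn

/-- A signed measure bounded above by the square of a finite nonatomic measure is nonpositive. -/
theorem signedMeasure_nonpos_of_le_sq_nonatomic {Ω : Type*} [MeasurableSpace Ω]
    {m : Measure Ω} [IsFiniteMeasure m]
    (hna : ∀ s : Set Ω, MeasurableSet s → 0 < m s →
      ∃ t ⊆ s, MeasurableSet t ∧ 0 < m t ∧ m t < m s)
    {ν : SignedMeasure Ω} {C : ℝ} (hν : ∀ s, MeasurableSet s → ν s ≤ C * m.real s ^ 2)
    {s : Set Ω} (hs : MeasurableSet s) : ν s ≤ 0 := by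
  by_contra! hpos
  obtain ⟨δ, hδ, hδs⟩ : ∃ δ > 0, δ * m.real s < ν s := by
    refine ⟨ν s / (m.real s + 1), by positivity, ?_⟩
    rw [div_mul_eq_mul_div, div_lt_iff₀ (by positivity)]
    nlinarith [measureReal_nonneg (μ := m) (s := s)]
  have happ {t : Set Ω} (ht : MeasurableSet t) :
      (δ • m.toSignedMeasure - ν) t = δ * m.real t - ν t := by
    simp [Measure.toSignedMeasure_apply_measurable ht]
  obtain ⟨j, hj, -, hneg, hjlt⟩ :=
    (δ • m.toSignedMeasure - ν).exists_subset_restrict_nonpos (i := s)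
      (by rw [happ hs]; linarith)
  rw [happ hj] at hjlt
  have hjpos : 0 < m.real j := by
    refine measureReal_nonneg.lt_of_ne fun h => ?_
    have := hν j hj
    rw [← h] at this hjlt
    linarith
  obtain ⟨t, htj, ht, htpos, htlt⟩ := exists_subset_measure_pos_lt_of_nonatomic hna hj
    (ENNReal.toReal_pos_iff.1 hjpos).1 (div_pos hδ (by positivity : 0 < |C| + 1))
  have h1 := VectorMeasure.subset_le_of_restrict_le_restrict _ _ hj hneg htj
  rw [happ ht, zero_apply] at h1
  have h2 := hν t ht
  rw [lt_div_iff₀ (by positivity)] at htlt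
  nlinarith [le_abs_self C, mul_pos htpos htpos]

/-- A finite measure with a density with respect to a nonatomic measure is nonatomic. -/
theorem withDensity_nonatomic {Ω : Type*} [MeasurableSpace Ω] {μ : Measure Ω}
    {g : Ω → ENNReal} (hg : Measurable g) [IsFiniteMeasure (μ.withDensity g)]
    (hna : ∀ s : Set Ω, MeasurableSet s → 0 < μ s →
      ∃ t ⊆ s, MeasurableSet t ∧ 0 < μ t ∧ μ t < μ s)
    {s : Set Ω} (hs : MeasurableSet s) (hpos : 0 < μ.withDensity g s) :
    ∃ t ⊆ s, MeasurableSet t ∧ 0 < μ.withDensity g t ∧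
      μ.withDensity g t < μ.withDensity g s := by
  have hsupp : MeasurableSet {x | g x ≠ 0} := (hg (measurableSet_singleton 0)).compl
  have hpos_iff {t : Set Ω} (ht : t ⊆ {x | g x ≠ 0}) :
      0 < μ.withDensity g t ↔ 0 < μ t := by
    rw [pos_iff_ne_zero, pos_iff_ne_zero, Ne, Ne, withDensity_apply_eq_zero hg,
      Set.inter_eq_right.2 ht]
  have hs0 : 0 < μ ({x | g x ≠ 0} ∩ s) := by
    rw [pos_iff_ne_zero] at hpos ⊢
    rwa [Ne, ← withDensity_apply_eq_zero hg]
  obtain ⟨t, hts, ht, htpos, htlt⟩ := hna _ (hsupp.inter hs) hs0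
  have hdiff : 0 < μ (({x | g x ≠ 0} ∩ s) \ t) :=
    (tsub_pos_of_lt htlt).trans_le le_measure_sdiff
  refine ⟨t, hts.trans Set.inter_subset_right, ht,
    (hpos_iff (hts.trans Set.inter_subset_left)).2 htpos, ?_⟩
  rw [← hpos_iff (Set.sdiff_subset.trans Set.inter_subset_left)] at hdiff
  rw [← measure_sdiff_add_inter s ht (μ := μ.withDensity g),
    Set.inter_eq_right.2 (hts.trans Set.inter_subset_right), add_comm]
  exact ENNReal.lt_add_right (measure_ne_top _ _) <|
    (hdiff.trans_le (measure_mono (Set.sdiff_subset_sdiff_left Set.inter_subset_right))).ne'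

/-- The indefinite integral of `f`, as a vector measure with values in `L¹(μ)`. -/
theorem exists_vectorMeasure_indicator {Ω : Type*} [MeasurableSpace Ω] {μ : Measure Ω}
    (f : Lp ℝ 1 μ) :
    ∃ F : VectorMeasure Ω (Lp ℝ 1 μ), ∀ s, MeasurableSet s →
      F s =ᵐ[μ] s.indicator f ∧ ‖F s‖ₑ = μ.withDensity (fun x => ‖f x‖ₑ) s := by
  classical
  have hf : Integrable f μ := L1.integrable_coeFn f
  have : IsFiniteMeasure (μ.withDensity fun x => ‖f x‖ₑ) :=
    isFiniteMeasure_withDensity hf.hasFiniteIntegral.ne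
  let F (s : Set Ω) : Lp ℝ 1 μ :=
    if hs : MeasurableSet s then (hf.indicator hs).toL1 _ else 0
  have hF {s : Set Ω} (hs : MeasurableSet s) : F s = (hf.indicator hs).toL1 _ := dif_pos hs
  have hF0 {s : Set Ω} (hs : ¬ MeasurableSet s) : F s = 0 := dif_neg hs
  have hnorm {s : Set Ω} (hs : MeasurableSet s) :
      ‖F s‖ₑ = μ.withDensity (fun x => ‖f x‖ₑ) s := by
    rw [hF hs, Integrable.enorm_toL1, withDensity_apply _ hs, ← lintegral_indicator hs]
    simp_rw [enorm_indicator_eq_indicator_enorm]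
  refine ⟨VectorMeasure.of_additive_of_le_measure (μ := μ.withDensity fun x => ‖f x‖ₑ) F
    (fun s => ?_) (fun s t hs ht hst => ?_) (fun s hs => hF0 hs),
    fun s hs => ⟨?_, hnorm hs⟩⟩
  · by_cases hs : MeasurableSet s
    · exact (hnorm hs).le
    · simp [hF0 hs]
  · rw [hF hs, hF ht, hF (hs.union ht), ← Integrable.toL1_add, Integrable.toL1_eq_toL1_iff,
      Set.indicator_union_of_disjoint hst]
    rfl
  · change F s =ᵐ[μ] _
    rw [hF hs]
    exact Integrable.coeFn_toL1 _

/-- There are no non-zero orthogonally additive continuous 2-homogeneous polynomials on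
`L¹(μ)` when `μ` is a finite nonatomic measure. -/
theorem no_orthogonally_additive_two_homogeneous_on_L1_nonatomic
    {Ω : Type*} [MeasurableSpace Ω] (μ : Measure Ω) [IsFiniteMeasure μ]
    (hna : ∀ s : Set Ω, MeasurableSet s → 0 < μ s →
      ∃ t ⊆ s, MeasurableSet t ∧ 0 < μ t ∧ μ t < μ s)
    (P : Lp ℝ 1 μ → ℝ)
    (A : Lp ℝ 1 μ →L[ℝ] Lp ℝ 1 μ →L[ℝ] ℝ)
    (hPA : ∀ f : Lp ℝ 1 μ, P f = A f f)
    (hOA : ∀ f g : Lp ℝ 1 μ, |f| ⊓ |g| = 0 → P (f + g) = P f + P g) :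
    ∀ f : Lp ℝ 1 μ, P f = 0 := by
  intro f
  obtain ⟨F, hF⟩ := exists_vectorMeasure_indicator f
  have hfin : IsFiniteMeasure (μ.withDensity fun x => ‖f x‖ₑ) :=
    isFiniteMeasure_withDensity (L1.integrable_coeFn f).hasFiniteIntegral.ne
  have hnorm (s : Set Ω) (hs : MeasurableSet s) :
      ‖F s‖ = (μ.withDensity fun x => ‖f x‖ₑ).real s := by
    rw [measureReal_def, ← (hF s hs).2, toReal_enorm]
  have huniv : F Set.univ = f := Lp.ext <| by
    simpa using (hF Set.univ MeasurableSet.univ).1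
  have hcompl (s : Set Ω) (hs : MeasurableSet s) : F s + F sᶜ = f := by
    rw [← VectorMeasure.of_union disjoint_compl_right hs hs.compl, Set.union_compl_self, huniv]
  have hdisj (s : Set Ω) (hs : MeasurableSet s) : |F s| ⊓ |F sᶜ| = 0 := by
    apply Lp.ext
    filter_upwards [Lp.coeFn_inf |F s| |F sᶜ|, Lp.coeFn_abs (F s), Lp.coeFn_abs (F sᶜ),
      (hF s hs).1, (hF sᶜ hs.compl).1, Lp.coeFn_zero ℝ 1 μ] with x h1 h2 h3 h4 h5 h6
    rw [h1, h6, Pi.inf_apply, h2, h3, h4, h5]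
    by_cases hx : x ∈ s <;> simp [hx]
  let L : Lp ℝ 1 μ →L[ℝ] ℝ := (1 / 2 : ℝ) • (A f + A.flip f)
  have hL (s : Set Ω) (hs : MeasurableSet s) : L (F s) = A (F s) (F s) := by
    have h := hOA _ _ (hdisj s hs)
    simp only [hPA, map_add, add_apply] at h
    have : L (F s) = 1 / 2 * (A f (F s) + A (F s) f) := rfl
    rw [this, ← hcompl s hs]
    simp only [map_add, add_apply]
    linarith
  let ν : SignedMeasure Ω := F.mapRange (L : Lp ℝ 1 μ →+ ℝ) L.continuous
  have hν (s : Set Ω) (hs : MeasurableSet s) : ν s = A (F s) (F s) := hL s hs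
  have hbound (s : Set Ω) (hs : MeasurableSet s) :
      |ν s| ≤ ‖A‖ * (μ.withDensity fun x => ‖f x‖ₑ).real s ^ 2 := by
    rw [hν s hs, ← hnorm s hs, sq, ← mul_assoc]
    exact A.le_opNorm₂ _ _
  have hatom (s : Set Ω) (hs : MeasurableSet s)
      (hpos : 0 < μ.withDensity (fun x => ‖f x‖ₑ) s) :=
    withDensity_nonatomic (Lp.stronglyMeasurable f).measurable.enorm hna hs hpos
  have hle := signedMeasure_nonpos_of_le_sq_nonatomic hatom
    (fun s hs => (le_abs_self _).trans (hbound s hs)) MeasurableSet.univ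
  have hge := signedMeasure_nonpos_of_le_sq_nonatomic (ν := -ν) hatom
    (fun s hs => (neg_le_abs _).trans (hbound s hs)) MeasurableSet.univ
  rw [neg_apply, neg_nonpos] at hge
  rw [hPA, ← huniv, ← hν _ MeasurableSet.univ]
  exact le_antisymm hle hge
end

section
/- Let K be a compact Hausdorff space, let μ be a regular Borel signed measure on K, let n be an odd positive integer, and let x ∈ C(K) with x ≥ 0. Then ∫_K x^n d|μ| = sup{ |∫_K y^n dμ| : y ∈ C(K), |y| ≤ x }. -/
open MeasureTheory

/-- Powers of a continuous function on a compact space are integrable for every finite Borel measure. -/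
lemma ContinuousMap.integrable_pow_of_isFiniteMeasure
    {K : Type*} [TopologicalSpace K] [CompactSpace K] [MeasurableSpace K] [BorelSpace K]
    (ν : Measure K) [IsFiniteMeasure ν] (y : C(K, ℝ)) (n : ℕ) :
    Integrable (fun t => y t ^ n) ν :=
  (y.continuous.pow n).integrable_of_hasCompactSupport (HasCompactSupport.of_compactSpace _)

/-- If `|y| ≤ x` then `|∫ y ^ n| ≤ ∫ x ^ n` for continuous functions on a compact space. -/
lemma ContinuousMap.abs_integral_pow_le_of_abs_le
    {K : Type*} [TopologicalSpace K] [CompactSpace K] [MeasurableSpace K] [BorelSpace K]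
    (ν : Measure K) [IsFiniteMeasure ν] {x y : C(K, ℝ)} (hxy : |y| ≤ x) (n : ℕ) :
    |∫ t, y t ^ n ∂ν| ≤ ∫ t, x t ^ n ∂ν := by
  refine abs_integral_le_integral_abs.trans
    (integral_mono (y.integrable_pow_of_isFiniteMeasure ν n).abs
      (x.integrable_pow_of_isFiniteMeasure ν n) fun t => ?_)
  exact (abs_pow (y t) n).trans_le (pow_le_pow_left₀ (abs_nonneg (y t)) (hxy t) n)

/-- Replacing `g` by its truncation to `[-1, 1]`, the powers stay close to `1` where `g` does. -/
lemma one_sub_clamp_pow_le (g : ℝ) (n : ℕ) :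
    1 - (max (-1) (min 1 g)) ^ n ≤ n * |1 - g| := by
  set h := max (-1) (min 1 g) with hh
  have h1 : -1 ≤ h := le_max_left _ _
  have hb := one_add_mul_le_pow (a := h - 1) (by linarith) n
  have h2 : 1 - h ≤ |1 - g| := by
    rw [hh]
    rcases le_total 1 g with hg | hg
    · rw [min_eq_left hg]
      norm_num
    · rw [min_eq_right hg]
      exact (sub_le_sub_left (le_max_right _ _) _).trans (le_abs_self _)
  have h3 : (n : ℝ) * (1 - h) ≤ n * |1 - g| := by gcongr
  rw [add_sub_cancel] at hb
  linarith

/-- For odd exponents, the powers of the truncation of `g` to `[-1, 1]` are close to `-1`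
where `g` is. -/
lemma one_add_clamp_pow_le (g : ℝ) {n : ℕ} (hn : Odd n) :
    1 + (max (-1) (min 1 g)) ^ n ≤ n * |-1 - g| := by
  have hneg : max (-1) (min 1 (-g)) = -max (-1) (min 1 g) := by
    rcases le_total 1 g with h1 | h1 <;> rcases le_total (-1) g with h2 | h2 <;> grind
  have h := one_sub_clamp_pow_le (-g) n
  rw [hneg, hn.neg_pow] at h
  have h4 : |1 - -g| = |-1 - g| := by rw [← abs_neg]; ring_nf
  rw [h4] at h
  linarith

/-- For mutually singular finite measures with regular sum, the signed integral of an odd power of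
a continuous function bounded by `x` gets arbitrarily close to the integral of that power of `x`
against the sum. -/
lemma exists_abs_le_integral_add_lt_of_mutuallySingular
    {K : Type*} [TopologicalSpace K] [CompactSpace K] [T2Space K]
    [MeasurableSpace K] [BorelSpace K]
    {P N : Measure K} [IsFiniteMeasure P] [IsFiniteMeasure N] (hPN : P ⟂ₘ N)
    (hreg : (P + N).Regular) {n : ℕ} (hn : Odd n) {x : C(K, ℝ)} (hx : 0 ≤ x)
    {ε : ℝ} (hε : 0 < ε) :
    ∃ y : C(K, ℝ), |y| ≤ x ∧
      (∫ t, x t ^ n ∂(P + N)) < (∫ t, y t ^ n ∂P) - (∫ t, y t ^ n ∂N) + ε := by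
  obtain ⟨s, hs, hPs, hNs⟩ := hPN
  classical
  let f : K → ℝ := s.piecewise (fun _ => -1) (fun _ => 1)
  have hf : Integrable f (P + N) :=
    Integrable.piecewise hs (integrable_const _).integrableOn (integrable_const _).integrableOn
  set C : ℝ := ‖x‖ ^ n * n with hC
  have hC0 : 0 ≤ C := by positivity
  obtain ⟨g, hg, hgi⟩ := hf.exists_boundedContinuous_integral_sub_le
    (ε := ε / (C + 1)) (by positivity)
  let h : C(K, ℝ) := ⟨fun t => max (-1) (min 1 (g t)), by fun_prop⟩
  have hd : Integrable (fun t => ‖f t - g t‖) (P + N) := (hf.sub hgi).norm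
  have hdP := hd.mono_measure (Measure.le_add_right le_rfl : P ≤ P + N)
  have hdN := hd.mono_measure (Measure.le_add_left le_rfl : N ≤ P + N)
  have hx0 : ∀ t, 0 ≤ x t := fun t => hx t
  have hxC : ∀ t, x t ^ n ≤ ‖x‖ ^ n := fun t =>
    pow_le_pow_left₀ (hx0 t) ((le_abs_self _).trans (x.norm_coe_le_norm t)) n
  refine ⟨x * h, fun t => ?_, ?_⟩
  · change |x t * h t| ≤ x t
    rw [abs_mul, abs_of_nonneg (hx0 t)]
    exact mul_le_of_le_one_right (hx0 t)
      (abs_le.2 ⟨le_max_left _ _, max_le (by norm_num) (min_le_left _ _)⟩)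
  have hiP := (x * h).integrable_pow_of_isFiniteMeasure P n
  have hiN := (x * h).integrable_pow_of_isFiniteMeasure N n
  have hxP := x.integrable_pow_of_isFiniteMeasure P n
  have hxN := x.integrable_pow_of_isFiniteMeasure N n
  have hP : ∫ t, (x t ^ n - (x * h) t ^ n) ∂P ≤ ∫ t, C * ‖f t - g t‖ ∂P := by
    refine integral_mono_ae (hxP.sub hiP) (hdP.const_mul C) ?_
    filter_upwards [measure_eq_zero_iff_ae_notMem.1 hPs] with t ht
    have hft : f t = 1 := Set.piecewise_eq_of_notMem _ _ _ ht
    have hb : 1 - h t ^ n ≤ n * |1 - g t| := one_sub_clamp_pow_le (g t) n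
    calc x t ^ n - (x * h) t ^ n = x t ^ n * (1 - h t ^ n) := by
          rw [ContinuousMap.mul_apply, mul_pow]; ring
      _ ≤ x t ^ n * (n * |1 - g t|) := mul_le_mul_of_nonneg_left hb (pow_nonneg (hx0 t) n)
      _ ≤ ‖x‖ ^ n * (n * |1 - g t|) := mul_le_mul_of_nonneg_right (hxC t) (by positivity)
      _ = C * ‖f t - g t‖ := by rw [hft, hC, Real.norm_eq_abs, mul_assoc]
  have hN : ∫ t, (x t ^ n + (x * h) t ^ n) ∂N ≤ ∫ t, C * ‖f t - g t‖ ∂N := by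
    refine integral_mono_ae (hxN.add hiN) (hdN.const_mul C) ?_
    filter_upwards [measure_eq_zero_iff_ae_notMem.1 hNs] with t ht
    have hft : f t = -1 := Set.piecewise_eq_of_mem _ _ _ (not_not.1 ht)
    have hb : 1 + h t ^ n ≤ n * |-1 - g t| := one_add_clamp_pow_le (g t) hn
    calc x t ^ n + (x * h) t ^ n = x t ^ n * (1 + h t ^ n) := by
          rw [ContinuousMap.mul_apply, mul_pow]; ring
      _ ≤ x t ^ n * (n * |-1 - g t|) := mul_le_mul_of_nonneg_left hb (pow_nonneg (hx0 t) n)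
      _ ≤ ‖x‖ ^ n * (n * |-1 - g t|) := mul_le_mul_of_nonneg_right (hxC t) (by positivity)
      _ = C * ‖f t - g t‖ := by rw [hft, hC, Real.norm_eq_abs, mul_assoc]
  rw [integral_sub hxP hiP, integral_const_mul] at hP
  rw [integral_add hxN hiN, integral_const_mul] at hN
  rw [integral_add_measure hdP hdN] at hg
  rw [integral_add_measure hxP hxN]
  have hCε : C * (ε / (C + 1)) < ε := by
    rw [mul_div_assoc', div_lt_iff₀ (by positivity)]
    nlinarith
  have := mul_le_mul_of_nonneg_left hg hC0
  linarith

/-- For a regular Borel signed measure `μ` on a compact Hausdorff space `K`, an odd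
positive integer `n` and `0 ≤ x` in `C(K)`, one has
`∫ x^n d|μ| = sup { |∫ y^n dμ| : y ∈ C(K), |y| ≤ x }`. -/
theorem abs_polynomial_odd_case
    {K : Type*} [TopologicalSpace K] [CompactSpace K] [T2Space K]
    [MeasurableSpace K] [BorelSpace K]
    (μ : SignedMeasure K) (hreg : μ.totalVariation.Regular)
    (n : ℕ) (hn : Odd n) (x : C(K, ℝ)) (hx : 0 ≤ x) :
    (∫ t, (x t) ^ n ∂μ.totalVariation) =
      sSup {r : ℝ | ∃ y : C(K, ℝ), |y| ≤ x ∧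
        r = |(∫ t, (y t) ^ n ∂μ.toJordanDecomposition.posPart)
              - ∫ t, (y t) ^ n ∂μ.toJordanDecomposition.negPart|} := by
  refine (csSup_eq_of_forall_le_of_forall_lt_exists_gt ?_ ?_ ?_).symm
  · exact ⟨_, 0, by simpa using hx, rfl⟩
  · rintro r ⟨y, hy, rfl⟩
    rw [SignedMeasure.totalVariation, integral_add_measure
      (x.integrable_pow_of_isFiniteMeasure _ n) (x.integrable_pow_of_isFiniteMeasure _ n)]
    exact (abs_sub _ _).trans (add_le_add
      (ContinuousMap.abs_integral_pow_le_of_abs_le _ hy n)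
      (ContinuousMap.abs_integral_pow_le_of_abs_le _ hy n))
  · intro w hw
    obtain ⟨y, hy, hlt⟩ := exists_abs_le_integral_add_lt_of_mutuallySingular
      μ.toJordanDecomposition.mutuallySingular hreg hn hx (sub_pos.2 hw)
    refine ⟨_, ⟨y, hy, rfl⟩, lt_of_lt_of_le ?_ (le_abs_self _)⟩
    rw [SignedMeasure.totalVariation] at hlt
    linarith
end

section
/- Let K be a compact Hausdorff space, let μ be a regular Borel signed measure on K, let n be an even positive integer, and let x ∈ C(K) with x ≥ 0. Then ∫_K x^n d|μ| ≤ 2 · sup{ |∫_K y^n dμ| : y ∈ C(K), |y| ≤ x }. -/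
open MeasureTheory

/-- For mutually singular finite measures `P`, `N` with regular sum, the measure `P` is nearly
separated from `N` by a continuous cutoff `y` of `x`. -/
lemma exists_abs_le_integral_pow_sub_ge {K : Type*} [TopologicalSpace K] [CompactSpace K]
    [T2Space K] [MeasurableSpace K] [BorelSpace K] (P N : Measure K) [IsFiniteMeasure P]
    [IsFiniteMeasure N] [(P + N).Regular] (hPN : P ⟂ₘ N) {n : ℕ} (hn : n ≠ 0) {x : C(K, ℝ)}
    (hx : 0 ≤ x) {ε : ℝ} (hε : 0 < ε) :
    ∃ y : C(K, ℝ), |y| ≤ x ∧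
      ∫ t, x t ^ n ∂P ≤ (∫ t, y t ^ n ∂P) - (∫ t, y t ^ n ∂N) + ε := by
  obtain ⟨S, hS, hPS, hNS⟩ := hPN
  set g : K → ℝ := Sᶜ.indicator 1 with hg
  have hgi : Integrable g (P + N) := (integrable_const (1 : ℝ)).indicator hS.compl
  obtain ⟨C, hC⟩ : ∃ C, ∀ t, x t ^ n ≤ C := by
    obtain ⟨C, hC⟩ := (isCompact_range (f := fun t => x t ^ n) (by fun_prop)).bddAbove
    exact ⟨C, fun t => hC ⟨t, rfl⟩⟩
  obtain ⟨δ, hδ, hCδ⟩ : ∃ δ > 0, |C| * δ ≤ ε :=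
    ⟨ε / (|C| + 1), by positivity, by
      rw [mul_div_assoc', div_le_iff₀ (by positivity)]; nlinarith [abs_nonneg C]⟩
  obtain ⟨f₀, hf₀, -⟩ := hgi.exists_boundedContinuous_integral_sub_le hδ
  set f : K → ℝ := fun t => max 0 (min 1 (f₀ t)) with hfdef
  have hf : Continuous f := by fun_prop
  have hf0 t : 0 ≤ f t := le_max_left _ _
  have hf1 t : f t ≤ 1 := max_le zero_le_one (min_le_left _ _)
  have hfg t : |g t - f t| ≤ |g t - f₀ t| := by
    have h : g t = 0 ∨ g t = 1 := by
      by_cases ht : t ∈ Sᶜ <;> simp [hg, ht]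
    simp only [hfdef]
    rcases h with h | h <;> rw [h] <;> grind
  have hxi (Q : Measure K) [IsFiniteMeasure Q] {h : K → ℝ} (hh : Continuous h) : Integrable h Q :=
    hh.integrable_of_hasCompactSupport (HasCompactSupport.of_compactSpace h)
  have hd : Integrable (fun t => |g t - f t|) (P + N) := (hgi.sub (hxi _ hf)).abs
  have hdP : Integrable (fun t => |g t - f t|) P := hd.left_of_add_measure
  have hdN : Integrable (fun t => |g t - f t|) N := hd.right_of_add_measure
  have hsum : (∫ t, |g t - f t| ∂P) + ∫ t, |g t - f t| ∂N ≤ δ := by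
    rw [← integral_add_measure hdP hdN]
    refine le_trans (integral_mono hd (hgi.sub (hxi _ f₀.continuous)).abs hfg) ?_
    simpa using hf₀
  have hy t : (x t * f t ^ ((n : ℝ)⁻¹)) ^ n = x t ^ n * f t := by
    rw [mul_pow, Real.rpow_inv_natCast_pow (hf0 t) hn]
  refine ⟨⟨fun t => x t * f t ^ ((n : ℝ)⁻¹),
    x.continuous.mul (hf.rpow_const fun _ => .inr (by positivity))⟩, ?_, ?_⟩
  · intro t
    have hxt : 0 ≤ x t := hx t
    change |x t * f t ^ ((n : ℝ)⁻¹)| ≤ x t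
    rw [abs_of_nonneg (mul_nonneg hxt (Real.rpow_nonneg (hf0 t) _))]
    exact mul_le_of_le_one_right hxt
      (Real.rpow_le_one (hf0 t) (hf1 t) (inv_nonneg.2 n.cast_nonneg))
  · simp only [ContinuousMap.coe_mk, hy]
    have hP : ∫ t, x t ^ n ∂P ≤ (∫ t, x t ^ n * f t ∂P) + |C| * ∫ t, |g t - f t| ∂P := by
      rw [← integral_const_mul, ← integral_add (hxi _ (by fun_prop)) (hdP.const_mul _)]
      refine integral_mono_ae (hxi _ (by fun_prop))
        ((hxi _ (by fun_prop)).add (hdP.const_mul _)) ?_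
      filter_upwards [compl_mem_ae_iff.mpr hPS] with t ht
      have : g t = 1 := by simp [hg, ht]
      rw [this]
      linarith [mul_le_mul ((hC t).trans (le_abs_self C)) (le_abs_self (1 - f t))
        (sub_nonneg.2 (hf1 t)) (abs_nonneg C)]
    have hN : ∫ t, x t ^ n * f t ∂N ≤ |C| * ∫ t, |g t - f t| ∂N := by
      rw [← integral_const_mul]
      refine integral_mono_ae (hxi _ (by fun_prop)) (hdN.const_mul _) ?_
      filter_upwards [compl_mem_ae_iff.mpr hNS] with t ht
      have : g t = 0 := by simpa [hg] using ht
      rw [this, zero_sub, abs_neg, abs_of_nonneg (hf0 t)]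
      exact mul_le_mul_of_nonneg_right ((hC t).trans (le_abs_self C)) (hf0 t)
    linarith [mul_le_mul_of_nonneg_left hsum (abs_nonneg C)]

/-- For a regular Borel signed measure `μ` on a compact Hausdorff space `K`, an odd
positive integer `n` and `0 ≤ x` in `C(K)`, one has
`∫ x^n d|μ| ≤ 2 * sup { |∫ y^n dμ| : y ∈ C(K), |y| ≤ x }`. -/
theorem abs_polynomial_even_case
    {K : Type*} [TopologicalSpace K] [CompactSpace K] [T2Space K]
    [MeasurableSpace K] [BorelSpace K]
    (μ : SignedMeasure K) (hreg : μ.totalVariation.Regular)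
    (n : ℕ) (hn : Even n) (hn0 : 0 < n) (x : C(K, ℝ)) (hx : 0 ≤ x) :
    (∫ t, (x t) ^ n ∂μ.totalVariation) ≤
      2 * sSup {r : ℝ | ∃ y : C(K, ℝ), |y| ≤ x ∧
        r = |(∫ t, (y t) ^ n ∂μ.toJordanDecomposition.posPart)
              - ∫ t, (y t) ^ n ∂μ.toJordanDecomposition.negPart|} := by
  have hsing := μ.toJordanDecomposition.mutuallySingular
  unfold SignedMeasure.totalVariation at hreg ⊢
  set P := μ.toJordanDecomposition.posPart
  set N := μ.toJordanDecomposition.negPart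
  set A := {r : ℝ | ∃ y : C(K, ℝ), |y| ≤ x ∧ r = |(∫ t, (y t) ^ n ∂P) - ∫ t, (y t) ^ n ∂N|}
  have hint (Q : Measure K) [IsFiniteMeasure Q] (y : C(K, ℝ)) :
      Integrable (fun t => y t ^ n) Q :=
    Continuous.integrable_of_hasCompactSupport (by fun_prop) (HasCompactSupport.of_compactSpace _)
  have hbd (Q : Measure K) [IsFiniteMeasure Q] (y : C(K, ℝ)) (hy : |y| ≤ x) :
      |∫ t, y t ^ n ∂Q| ≤ ∫ t, x t ^ n ∂Q := by
    refine abs_integral_le_integral_abs.trans (integral_mono (hint Q y).abs (hint Q x) fun t => ?_)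
    change |y t ^ n| ≤ x t ^ n
    rw [abs_pow]
    exact pow_le_pow_left₀ (abs_nonneg (y t)) (hy t) n
  have hA : BddAbove A := by
    refine ⟨(∫ t, x t ^ n ∂P) + ∫ t, x t ^ n ∂N, ?_⟩
    rintro _ ⟨y, hy, rfl⟩
    exact (abs_sub _ _).trans (add_le_add (hbd P y hy) (hbd N y hy))
  have hPle : ∫ t, x t ^ n ∂P ≤ sSup A := by
    refine le_of_forall_pos_le_add fun ε hε => ?_
    obtain ⟨y, hy, h⟩ := exists_abs_le_integral_pow_sub_ge P N hsing hn0.ne' hx hε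
    have := le_csSup hA ⟨y, hy, rfl⟩
    linarith [le_abs_self ((∫ t, y t ^ n ∂P) - ∫ t, y t ^ n ∂N)]
  have hNle : ∫ t, x t ^ n ∂N ≤ sSup A := by
    refine le_of_forall_pos_le_add fun ε hε => ?_
    have : (N + P).Regular := by rwa [add_comm]
    obtain ⟨y, hy, h⟩ := exists_abs_le_integral_pow_sub_ge N P hsing.symm hn0.ne' hx hε
    have := le_csSup hA ⟨y, hy, rfl⟩
    linarith [neg_abs_le ((∫ t, y t ^ n ∂P) - ∫ t, y t ^ n ∂N)]
  rw [integral_add_measure (hint P x) (hint N x)]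
  linarith
end

section
/- Let K be a compact Hausdorff space, let μ be a regular Borel signed measure on K, and let n be an odd positive integer. Then sup{ |∫_K x^n dμ| : x ∈ C(K), ‖x‖∞ ≤ 1 } = |μ|(K), the total variation norm of μ. (Equivalently, the supremum norm of the orthogonally additive n-homogeneous polynomial P(x) = ∫_K x^n dμ equals its regular norm ‖μ‖₁.) -/
open MeasureTheory

/-- If `f` is bounded below by `-1` and equals `1` off a set of small measure, then its
integral is almost at least the total mass. -/
theorem measureReal_univ_sub_le_integral_of_eq_one {α : Type*} [MeasurableSpace α]
    (ν : Measure α) [IsFiniteMeasure ν] {f : α → ℝ} (hf : Integrable f ν)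
    (hlow : ∀ t, -1 ≤ f t) {s : Set α} (hs : MeasurableSet s) (hone : ∀ t ∈ s, f t = 1) :
    ν.real Set.univ - 2 * ν.real sᶜ ≤ ∫ t, f t ∂ν := by
  have hind : Integrable (sᶜ.indicator fun _ => (2 : ℝ)) ν :=
    (integrable_const 2).indicator hs.compl
  have hle : ∫ t, ((1 : ℝ) - sᶜ.indicator (fun _ => (2 : ℝ)) t) ∂ν ≤ ∫ t, f t ∂ν := by
    refine integral_mono ((integrable_const 1).sub hind) hf fun t => ?_
    by_cases ht : t ∈ s
    · simp [ht, hone t ht]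
    · have := hlow t
      simp only [Set.mem_compl_iff, ht, not_false_eq_true, Set.indicator_of_mem]
      linarith
  rw [integral_sub (integrable_const 1) hind, integral_indicator_const _ hs.compl] at hle
  simp only [integral_const, smul_eq_mul, mul_one] at hle
  linarith

/-- In a normal space, disjoint closed sets are separated by a continuous function with values in
`[-1, 1]` which is `1` on the first and `-1` on the second. -/
theorem exists_continuous_one_neg_one_of_isClosed {X : Type*} [TopologicalSpace X] [NormalSpace X]
    {s t : Set X} (hs : IsClosed s) (ht : IsClosed t) (hd : Disjoint s t) :
    ∃ g : C(X, ℝ), (∀ x ∈ s, g x = 1) ∧ (∀ x ∈ t, g x = -1) ∧ ∀ x, |g x| ≤ 1 := by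
  obtain ⟨f, hf0, hf1, hf⟩ := exists_continuous_zero_one_of_isClosed ht hs hd.symm
  refine ⟨(2 : ℝ) • f - 1, fun x hx => ?_, fun x hx => ?_, fun x => ?_⟩
  · have := hf1 hx
    simp only [Pi.one_apply] at this
    norm_num [this]
  · have := hf0 hx
    simp only [Pi.zero_apply] at this
    simp [this]
  · obtain ⟨h0, h1⟩ := hf x
    simp only [ContinuousMap.sub_apply, ContinuousMap.smul_apply, ContinuousMap.one_apply,
      smul_eq_mul, abs_le]
    constructor <;> linarith

/-- For mutually singular finite measures with regular sum, there are disjoint compact sets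
carrying them up to `ε`. -/
theorem exists_disjoint_isCompact_measureReal_compl_le {X : Type*} [TopologicalSpace X] [T2Space X]
    [MeasurableSpace X] [BorelSpace X] (P N : Measure X) [IsFiniteMeasure P] [IsFiniteMeasure N]
    (hPN : P ⟂ₘ N) (hreg : (P + N).Regular) {ε : ℝ} (hε : 0 < ε) :
    ∃ s t : Set X, IsCompact s ∧ IsCompact t ∧ Disjoint s t ∧
      P.real sᶜ ≤ ε ∧ N.real tᶜ ≤ ε := by
  obtain ⟨A, hA, hPA, hNA⟩ := hPN
  have hε' : ENNReal.ofReal ε ≠ 0 := by simpa using hε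
  obtain ⟨s, hsA, hs, hsε⟩ :=
    hA.compl.exists_isCompact_sdiff_lt (μ := P + N) (measure_ne_top _ _) hε'
  obtain ⟨t, htA, ht, htε⟩ := hA.exists_isCompact_sdiff_lt (μ := P + N) (measure_ne_top _ _) hε'
  have key : ∀ (ν : Measure X) (B u : Set X), ν ≤ P + N → ν Bᶜ = 0 →
      (P + N) (B \ u) < ENNReal.ofReal ε → ν.real uᶜ ≤ ε := by
    intro ν B u hν hB hu
    refine ENNReal.toReal_le_of_le_ofReal hε.le ?_
    calc ν uᶜ ≤ ν (Bᶜ ∪ B \ u) := measure_mono fun x hx => by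
          by_cases hxB : x ∈ B
          · exact Or.inr ⟨hxB, hx⟩
          · exact Or.inl hxB
      _ ≤ ν Bᶜ + ν (B \ u) := measure_union_le _ _
      _ ≤ (P + N) (B \ u) := by rw [hB, zero_add]; exact hν _
      _ ≤ ENNReal.ofReal ε := hu.le
  exact ⟨s, t, hs, ht, (disjoint_compl_left.mono hsA htA),
    key P Aᶜ s (Measure.le_add_right le_rfl) (by rwa [compl_compl]) hsε,
    key N A t (Measure.le_add_left le_rfl) hNA htε⟩

/-- For a regular Borel signed measure `μ` on a compact Hausdorff space `K` and an odd
positive integer `n`, the supremum norm of the polynomial `x ↦ ∫ x^n dμ` equals the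
total variation norm `|μ|(K)`. -/
theorem sup_norm_eq_variation_norm_odd
    {K : Type*} [TopologicalSpace K] [CompactSpace K] [T2Space K]
    [MeasurableSpace K] [BorelSpace K]
    (μ : SignedMeasure K) (hreg : μ.totalVariation.Regular)
    (n : ℕ) (hn : Odd n) :
    sSup {r : ℝ | ∃ x : C(K, ℝ), ‖x‖ ≤ 1 ∧
        r = |(∫ t, (x t) ^ n ∂μ.toJordanDecomposition.posPart)
              - ∫ t, (x t) ^ n ∂μ.toJordanDecomposition.negPart|} =
      (μ.totalVariation Set.univ).toReal := by
  set P := μ.toJordanDecomposition.posPart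
  set N := μ.toJordanDecomposition.negPart
  have htot : (μ.totalVariation Set.univ).toReal = P.real Set.univ + N.real Set.univ := by
    rw [SignedMeasure.totalVariation, Measure.add_apply,
      ENNReal.toReal_add (measure_ne_top _ _) (measure_ne_top _ _)]
    rfl
  rw [htot]
  refine csSup_eq_of_forall_le_of_forall_lt_exists_gt ⟨_, 0, by simp, rfl⟩ ?_ ?_
  · rintro r ⟨x, hx, rfl⟩
    have hbound (ν : Measure K) [IsFiniteMeasure ν] : |∫ t, (x t) ^ n ∂ν| ≤ ν.real Set.univ := by
      simpa using norm_integral_le_of_norm_le_const (μ := ν) (f := fun t => x t ^ n) (C := 1)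
        (Filter.Eventually.of_forall fun t => by
          rw [norm_pow]
          exact pow_le_one₀ (norm_nonneg _) ((x.norm_coe_le_norm t).trans hx))
    exact (abs_sub _ _).trans (add_le_add (hbound P) (hbound N))
  · intro w hw
    obtain ⟨s, t, hs, ht, hd, hPs, hNt⟩ := exists_disjoint_isCompact_measureReal_compl_le P N
      μ.toJordanDecomposition.mutuallySingular hreg
      (ε := (P.real Set.univ + N.real Set.univ - w) / 5) (by linarith)
    obtain ⟨g, hgs, hgt, hg⟩ :=
      exists_continuous_one_neg_one_of_isClosed hs.isClosed ht.isClosed hd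
    have hgn : ∀ y, |g y ^ n| ≤ 1 := fun y => by
      rw [abs_pow]
      exact pow_le_one₀ (abs_nonneg _) (hg y)
    have hint (ν : Measure K) [IsFiniteMeasure ν] : Integrable (fun y => g y ^ n) ν :=
      .of_bound (g.continuous.pow n).measurable.aestronglyMeasurable 1
        (Filter.Eventually.of_forall hgn)
    have hPint := measureReal_univ_sub_le_integral_of_eq_one P (hint P)
      (fun y => (abs_le.1 (hgn y)).1) hs.measurableSet (fun y hy => by simp [hgs y hy])
    have hNint := measureReal_univ_sub_le_integral_of_eq_one N (hint N).neg
      (fun y => neg_le_neg (abs_le.1 (hgn y)).2) ht.measurableSet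
      (fun y hy => by simp [hgt y hy, hn.neg_one_pow])
    simp only [Pi.neg_apply, integral_neg] at hNint
    refine ⟨_, ⟨g, (g.norm_le zero_le_one).2 hg, rfl⟩, lt_of_lt_of_le ?_ (le_abs_self _)⟩
    linarith
end

section
/- Let K be a compact Hausdorff space, let μ be a regular Borel signed measure on K, and let n be an even positive integer. Then sup{ |∫_K x^n dμ| : x ∈ C(K), ‖x‖∞ ≤ 1 } = max{ μ⁺(K), μ⁻(K) }. -/
open MeasureTheory

/-- For mutually singular finite measures `P`, `N` with regular sum, some continuous function with
values in `[0, 1]` has powers with `P`-integral close to `P univ` and `N`-integral close to `0`. -/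
theorem exists_continuousMap_integral_pow_sub_ge
    {K : Type*} [TopologicalSpace K] [CompactSpace K] [T2Space K]
    [MeasurableSpace K] [BorelSpace K]
    (P N : Measure K) [IsFiniteMeasure P] [IsFiniteMeasure N] (hPN : P.MutuallySingular N)
    (hreg : (P + N).Regular) (n : ℕ) (hn0 : n ≠ 0) {ε : ℝ} (hε : 0 < ε) :
    ∃ x : C(K, ℝ), ‖x‖ ≤ 1 ∧
      P.real Set.univ - ε ≤ (∫ t, (x t) ^ n ∂P) - ∫ t, (x t) ^ n ∂N := by
  obtain ⟨S, hS, hPS, hNS⟩ := hPN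
  have hδ : ENNReal.ofReal (ε / 2) ≠ 0 := by simpa using hε
  obtain ⟨F, hFA, hF, hFlt⟩ :=
    hS.compl.exists_isClosed_sdiff_lt (measure_ne_top (P + N) _) hδ
  obtain ⟨U, hAU, hU, -, hUlt⟩ :=
    hS.compl.exists_isOpen_sdiff_lt (measure_ne_top (P + N) _) hδ
  have hdisj : Disjoint Uᶜ F :=
    Set.disjoint_left.2 fun t ht htF => ht (hAU (hFA htF))
  obtain ⟨f, hf0, hf1, hf⟩ := exists_continuous_zero_one_of_isClosed hU.isClosed_compl hF hdisj
  have hint (m : Measure K) [IsFiniteMeasure m] : Integrable (fun t => f t ^ n) m :=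
    (f.continuous.pow n).integrable_of_hasCompactSupport (HasCompactSupport.of_compactSpace _)
  refine ⟨f, (ContinuousMap.norm_le _ zero_le_one).2 fun t => ?_, ?_⟩
  · rw [Real.norm_of_nonneg (hf t).1]
    exact (hf t).2
  have hPF : P.real F ≤ ∫ t, f t ^ n ∂P := by
    rw [← integral_indicator_one hF.measurableSet]
    refine integral_mono ((integrable_const 1).indicator hF.measurableSet) (hint P) fun t => ?_
    by_cases ht : t ∈ F
    · simp [ht, hf1 ht]
    · simpa [ht] using pow_nonneg (hf t).1 n
  have hNU : ∫ t, f t ^ n ∂N ≤ N.real U := by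
    rw [← integral_indicator_one hU.measurableSet]
    refine integral_mono (hint N) ((integrable_const 1).indicator hU.measurableSet) fun t => ?_
    by_cases ht : t ∈ U
    · simpa [ht] using pow_le_one₀ (hf t).1 (hf t).2
    · simp [ht, hf0 (Set.mem_compl ht), hn0]
  have hP : P.real Set.univ ≤ P.real F + ε / 2 := by
    have hdiff : P.real (Sᶜ \ F) ≤ ε / 2 :=
      ENNReal.toReal_le_of_le_ofReal (by positivity)
        ((Measure.le_add_right le_rfl (Sᶜ \ F)).trans hFlt.le)
    have hS0 : P.real S = 0 := by simp [Measure.real, hPS]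
    have hcover : (Set.univ : Set K) ⊆ S ∪ (F ∪ Sᶜ \ F) := fun t _ => by
      by_cases h1 : t ∈ S <;> by_cases h2 : t ∈ F <;> simp [h1, h2]
    have h1 := measureReal_mono (μ := P) hcover
    have h2 := measureReal_union_le (μ := P) S (F ∪ Sᶜ \ F)
    have h3 := measureReal_union_le (μ := P) F (Sᶜ \ F)
    linarith
  have hN : N.real U ≤ ε / 2 := by
    have hdiff : N.real (U \ Sᶜ) ≤ ε / 2 :=
      ENNReal.toReal_le_of_le_ofReal (by positivity)
        ((Measure.le_add_left le_rfl (U \ Sᶜ)).trans hUlt.le)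
    have hS0 : N.real Sᶜ = 0 := by simp [Measure.real, hNS]
    have hcover : U ⊆ Sᶜ ∪ U \ Sᶜ := by rw [Set.union_sdiff_self]; exact Set.subset_union_right
    have h1 := measureReal_mono (μ := N) hcover
    have h2 := measureReal_union_le (μ := N) Sᶜ (U \ Sᶜ)
    linarith
  linarith

/-- The integral of an even power of a continuous function of norm at most one lies between `0`
and the total mass. -/
theorem integral_even_pow_mem_Icc
    {K : Type*} [TopologicalSpace K] [CompactSpace K] [MeasurableSpace K]
    (P : Measure K) [IsFiniteMeasure P] {n : ℕ} (hn : Even n) {x : C(K, ℝ)} (hx : ‖x‖ ≤ 1) :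
    ∫ t, (x t) ^ n ∂P ∈ Set.Icc 0 (P.real Set.univ) := by
  refine ⟨integral_nonneg fun t => hn.pow_nonneg _, ?_⟩
  have h := norm_integral_le_of_norm_le_const (μ := P) (f := fun t => (x t) ^ n) (C := 1)
    (.of_forall fun t => by
      rw [norm_pow]
      exact pow_le_one₀ (norm_nonneg _) ((x.norm_coe_le_norm t).trans hx))
  rw [one_mul] at h
  exact (Real.le_norm_self _).trans h

/-- For a regular Borel signed measure `μ` on a compact Hausdorff space `K` and an even
positive integer `n`, the supremum norm of the polynomial `x ↦ ∫ x^n dμ` equals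
`max {μ⁺(K), μ⁻(K)}`. -/
theorem sup_norm_eq_norm_zero_even
    {K : Type*} [TopologicalSpace K] [CompactSpace K] [T2Space K]
    [MeasurableSpace K] [BorelSpace K]
    (μ : SignedMeasure K) (hreg : μ.totalVariation.Regular)
    (n : ℕ) (hn : Even n) (hn0 : 0 < n) :
    sSup {r : ℝ | ∃ x : C(K, ℝ), ‖x‖ ≤ 1 ∧
        r = |(∫ t, (x t) ^ n ∂μ.toJordanDecomposition.posPart)
              - ∫ t, (x t) ^ n ∂μ.toJordanDecomposition.negPart|} =
      max (μ.toJordanDecomposition.posPart Set.univ).toReal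
          (μ.toJordanDecomposition.negPart Set.univ).toReal := by
  set P := μ.toJordanDecomposition.posPart
  set N := μ.toJordanDecomposition.negPart
  have hPN : P.MutuallySingular N := μ.toJordanDecomposition.mutuallySingular
  have hreg' : (P + N).Regular := hreg
  have hreg'' : (N + P).Regular := add_comm P N ▸ hreg'
  refine IsLUB.csSup_eq ⟨?_, fun b hb => ?_⟩ ⟨_, 0, by simp, rfl⟩
  · rintro r ⟨x, hx, rfl⟩
    obtain ⟨hP0, hP1⟩ := integral_even_pow_mem_Icc P hn hx
    obtain ⟨hN0, hN1⟩ := integral_even_pow_mem_Icc N hn hx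
    exact abs_le.2 ⟨by
      have := le_max_right (P.real Set.univ) (N.real Set.univ)
      simp only [Measure.real] at *
      linarith, by
      have := le_max_left (P.real Set.univ) (N.real Set.univ)
      simp only [Measure.real] at *
      linarith⟩
  · refine max_le (le_of_forall_pos_le_add fun ε hε => ?_) (le_of_forall_pos_le_add fun ε hε => ?_)
    · obtain ⟨x, hx, h⟩ :=
        exists_continuousMap_integral_pow_sub_ge P N hPN hreg' n hn0.ne' hε
      exact sub_le_iff_le_add.1 (h.trans ((le_abs_self _).trans (hb ⟨x, hx, rfl⟩)))
    · obtain ⟨x, hx, h⟩ :=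
        exists_continuousMap_integral_pow_sub_ge N P hPN.symm hreg'' n hn0.ne' hε
      refine sub_le_iff_le_add.1 (h.trans ((le_abs_self _).trans ?_))
      rw [abs_sub_comm]
      exact hb ⟨x, hx, rfl⟩
end

section
/- Let K be a compact Hausdorff space, let n be a positive integer, and let μ be a regular Borel signed measure on K. If ∫_K x^n dμ = 0 for every x ∈ C(K), then μ = 0. (That is, the map J_n from regular Borel signed measures to orthogonally additive n-homogeneous polynomials, J_n(μ)(x) = ∫_K x^n dμ, is injective.) -/
open MeasureTheory

/-- If the sum of two mutually singular measures is finite and regular, then so is the first. -/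
theorem MeasureTheory.Measure.MutuallySingular.regular_left_of_add
    {X : Type*} [TopologicalSpace X] [R1Space X] [MeasurableSpace X] [BorelSpace X]
    {μ ν : Measure X} [IsFiniteMeasure μ] [IsFiniteMeasure ν]
    (hμν : μ ⟂ₘ ν) (hreg : (μ + ν).Regular) : μ.Regular := by
  have hμ : (μ + ν).restrict hμν.nullSetᶜ = μ := by
    rw [Measure.restrict_add, hμν.restrict_compl_nullSet, add_zero]
    exact Measure.restrict_eq_self_of_ae_mem (measure_eq_zero_iff_ae_notMem.1 hμν.measure_nullSet)
  rw [← hμ]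
  exact Measure.Regular.restrict_of_measure_ne_top (measure_ne_top _ _)

/-- The map sending a regular Borel signed measure `μ` on a compact Hausdorff space `K`
to the orthogonally additive `n`-homogeneous polynomial `x ↦ ∫ x^n dμ` is injective:
if `∫ x^n dμ = 0` for every `x ∈ C(K)`, then `μ = 0`. -/
theorem signed_measure_eq_zero_of_integral_pow_eq_zero
    {K : Type*} [TopologicalSpace K] [CompactSpace K] [T2Space K]
    [MeasurableSpace K] [BorelSpace K]
    (μ : SignedMeasure K) (hreg : μ.totalVariation.Regular)
    (n : ℕ) (hn : 0 < n)
    (h : ∀ x : C(K, ℝ),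
      (∫ t, (x t) ^ n ∂μ.toJordanDecomposition.posPart)
        - ∫ t, (x t) ^ n ∂μ.toJordanDecomposition.negPart = 0) :
    μ = 0 := by
  set j := μ.toJordanDecomposition with hj
  have hadd : (j.posPart + j.negPart).Regular := hreg
  have hpos : j.posPart.Regular := j.mutuallySingular.regular_left_of_add hadd
  have hneg : j.negPart.Regular :=
    j.mutuallySingular.symm.regular_left_of_add (add_comm j.posPart j.negPart ▸ hadd)
  have heq : j.posPart = j.negPart := by
    refine Measure.ext_of_integral_eq_on_compactlySupported_nnreal fun f ↦ ?_
    have hroot : Continuous fun t ↦ (f t : ℝ) ^ (n⁻¹ : ℝ) :=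
      (NNReal.continuous_coe.comp f.continuous).rpow_const fun _ ↦ Or.inr (by positivity)
    have hf := sub_eq_zero.1 (h ⟨_, hroot⟩)
    simpa only [ContinuousMap.coe_mk, Real.rpow_inv_natCast_pow (NNReal.coe_nonneg _) hn.ne']
      using hf
  rw [← μ.toSignedMeasure_toJordanDecomposition, ← hj, JordanDecomposition.toSignedMeasure,
    sub_eq_zero]
  simp only [heq]
end

section
/- Let K be a nonempty compact Hausdorff space. For every x ∈ C(K) one has ‖x⁺‖∞ + ‖x⁻‖∞ = max{ ‖x‖∞, ρ(x) }, where ρ(x) = sup{ |x(s) − x(t)| : s, t ∈ K } is the diameter seminorm. In particular ‖x‖_d := ‖x⁺‖∞ + ‖x⁻‖∞ defines a norm on C(K). -/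
section PositivePart

variable {K : Type*} [TopologicalSpace K] [CompactSpace K]

lemma apply_le_norm_sup_zero (x : C(K, ℝ)) (s : K) : x s ≤ ‖x ⊔ 0‖ :=
  (le_max_left (x s) 0).trans ((le_abs_self _).trans ((x ⊔ 0).norm_coe_le_norm s))

lemma norm_sup_zero_le_iff (x : C(K, ℝ)) {M : ℝ} (hM : 0 ≤ M) :
    ‖x ⊔ 0‖ ≤ M ↔ ∀ s, x s ≤ M := by
  refine ⟨fun h s => (apply_le_norm_sup_zero x s).trans h, fun h => ?_⟩
  refine (ContinuousMap.norm_le _ hM).2 fun s => ?_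
  change |max (x s) 0| ≤ M
  rw [abs_of_nonneg (le_max_right _ _)]
  exact max_le (h s) hM

lemma exists_norm_sup_zero_eq [Nonempty K] (x : C(K, ℝ)) : ∃ s, ‖x ⊔ 0‖ = max (x s) 0 := by
  obtain ⟨s, -, hs⟩ :=
    isCompact_univ.exists_isMaxOn Set.univ_nonempty x.continuous.continuousOn
  refine ⟨s, le_antisymm ?_ (max_le (apply_le_norm_sup_zero x s) (norm_nonneg _))⟩
  exact (norm_sup_zero_le_iff x (le_max_right _ _)).2
    fun t => (hs (Set.mem_univ t)).trans (le_max_left _ _)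

lemma norm_add_sup_zero_le (x y : C(K, ℝ)) : ‖(x + y) ⊔ 0‖ ≤ ‖x ⊔ 0‖ + ‖y ⊔ 0‖ :=
  (norm_sup_zero_le_iff _ (by positivity)).2
    fun s => add_le_add (apply_le_norm_sup_zero x s) (apply_le_norm_sup_zero y s)

lemma norm_smul_sup_zero {c : ℝ} (hc : 0 ≤ c) (x : C(K, ℝ)) :
    ‖(c • x) ⊔ 0‖ = c * ‖x ⊔ 0‖ := by
  have h : (c • x) ⊔ 0 = c • (x ⊔ 0) := by
    ext s
    change max (c * x s) 0 = c * max (x s) 0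
    rw [mul_max_of_nonneg _ _ hc, mul_zero]
  rw [h, norm_smul, Real.norm_of_nonneg hc]

lemma norm_le_norm_sup_zero_add (x : C(K, ℝ)) : ‖x‖ ≤ ‖x ⊔ 0‖ + ‖(-x) ⊔ 0‖ := by
  refine (ContinuousMap.norm_le _ (by positivity)).2 fun s => ?_
  have h₁ := apply_le_norm_sup_zero x s
  have h₂ : -x s ≤ ‖(-x) ⊔ 0‖ := apply_le_norm_sup_zero (-x) s
  exact abs_le.2 ⟨by linarith [norm_nonneg (x ⊔ 0)], by linarith [norm_nonneg ((-x) ⊔ 0)]⟩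

lemma abs_sub_le_norm_sup_zero_add (x : C(K, ℝ)) (s t : K) :
    |x s - x t| ≤ ‖x ⊔ 0‖ + ‖(-x) ⊔ 0‖ := by
  have h (u : K) : -x u ≤ ‖(-x) ⊔ 0‖ := apply_le_norm_sup_zero (-x) u
  exact abs_le.2 ⟨by linarith [h s, apply_le_norm_sup_zero x t],
    by linarith [h t, apply_le_norm_sup_zero x s]⟩

lemma norm_sup_zero_add_eq_max [Nonempty K] (x : C(K, ℝ)) :
    ‖x ⊔ 0‖ + ‖(-x) ⊔ 0‖ = max ‖x‖ (sSup {r : ℝ | ∃ s t : K, r = |x s - x t|}) := by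
  have hub : ‖x ⊔ 0‖ + ‖(-x) ⊔ 0‖ ∈ upperBounds {r : ℝ | ∃ s t : K, r = |x s - x t|} := by
    rintro _ ⟨s, t, rfl⟩
    exact abs_sub_le_norm_sup_zero_add x s t
  apply le_antisymm
  · obtain ⟨s, hs⟩ := exists_norm_sup_zero_eq x
    obtain ⟨t, ht⟩ := exists_norm_sup_zero_eq (-x)
    rw [ContinuousMap.neg_apply] at ht
    have hxs := abs_le.1 (x.norm_coe_le_norm s)
    have hxt := abs_le.1 (x.norm_coe_le_norm t)
    have hst := (le_abs_self _).trans (le_csSup ⟨_, hub⟩ ⟨s, t, rfl⟩)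
    rw [hs, ht]
    rcases max_cases (x s) 0 with ⟨h₁, -⟩ | ⟨h₁, -⟩ <;>
      rcases max_cases (-x t) 0 with ⟨h₂, -⟩ | ⟨h₂, -⟩ <;> rw [h₁, h₂]
    · exact le_max_of_le_right (by linarith)
    · exact le_max_of_le_left (by linarith)
    · exact le_max_of_le_left (by linarith)
    · exact le_max_of_le_left (by linarith [norm_nonneg x])
  · obtain ⟨s⟩ := ‹Nonempty K›
    exact max_le (norm_le_norm_sup_zero_add x) (csSup_le ⟨_, s, s, rfl⟩ hub)

end PositivePart

/-- On a nonempty compact Hausdorff space `K`, `‖x⁺‖∞ + ‖x⁻‖∞ = max {‖x‖∞, ρ(x)}` for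
every `x ∈ C(K)`, where `ρ` is the diameter seminorm; in particular
`‖x‖_d = ‖x⁺‖∞ + ‖x⁻‖∞` defines a norm on `C(K)`. -/
theorem d_norm_eq_max_sup_diam
    {K : Type*} [TopologicalSpace K] [CompactSpace K] [T2Space K] [Nonempty K] :
    (∀ x : C(K, ℝ),
        ‖x ⊔ 0‖ + ‖(-x) ⊔ 0‖ =
          max ‖x‖ (sSup {r : ℝ | ∃ s t : K, r = |x s - x t|})) ∧
    (∀ x : C(K, ℝ), ‖x ⊔ 0‖ + ‖(-x) ⊔ 0‖ = 0 ↔ x = 0) ∧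
    (∀ (c : ℝ) (x : C(K, ℝ)),
        ‖(c • x) ⊔ 0‖ + ‖(-(c • x)) ⊔ 0‖ = |c| * (‖x ⊔ 0‖ + ‖(-x) ⊔ 0‖)) ∧
    (∀ x y : C(K, ℝ),
        ‖(x + y) ⊔ 0‖ + ‖(-(x + y)) ⊔ 0‖ ≤
          (‖x ⊔ 0‖ + ‖(-x) ⊔ 0‖) + (‖y ⊔ 0‖ + ‖(-y) ⊔ 0‖)) := by
  refine ⟨norm_sup_zero_add_eq_max, fun x => ⟨fun h => ?_, ?_⟩, fun c x => ?_, fun x y => ?_⟩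
  · exact norm_le_zero_iff.1 ((norm_le_norm_sup_zero_add x).trans_eq h)
  · rintro rfl
    simp
  · rcases le_total 0 c with hc | hc
    · rw [← smul_neg, norm_smul_sup_zero hc, norm_smul_sup_zero hc, abs_of_nonneg hc, mul_add]
    · have hc' : 0 ≤ -c := neg_nonneg.2 hc
      rw [← neg_smul, ← neg_smul_neg c x, norm_smul_sup_zero hc', norm_smul_sup_zero hc',
        abs_of_nonpos hc]
      ring
  · rw [neg_add]
    linarith [norm_add_sup_zero_le x y, norm_add_sup_zero_le (-x) (-y)]
end

section
/- Let K be a compact Hausdorff space and let μ be a regular Borel signed measure on K. Then sup{ |∫_K x dμ| : x ∈ C(K), ‖x⁺‖∞ + ‖x⁻‖∞ ≤ 1 } = max{ μ⁺(K), μ⁻(K) }. (That is, the dual norm of ‖·‖_d on C(K) is the norm ‖μ‖₀ = max{‖μ⁺‖₁, ‖μ⁻‖₁} on the space of regular Borel signed measures.) -/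
open MeasureTheory

/-- A continuous function with `0 ≤ f ≤ 1` almost realises the mass of one of two mutually singular
finite measures while having almost zero integral against the other. -/
theorem exists_continuousMap_lt_integral_sub_integral
    {K : Type*} [TopologicalSpace K] [CompactSpace K] [T2Space K]
    [MeasurableSpace K] [BorelSpace K] (P N : Measure K) [IsFiniteMeasure P] [IsFiniteMeasure N]
    (hPN : P.MutuallySingular N) (hreg : (P + N).Regular) {ε : ℝ} (hε : 0 < ε) :
    ∃ f : C(K, ℝ), (∀ t, 0 ≤ f t ∧ f t ≤ 1) ∧
      P.real Set.univ - ε < (∫ t, f t ∂P) - ∫ t, f t ∂N := by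
  obtain ⟨S, hS, hPS, hNS⟩ := hPN
  have hδ : ENNReal.ofReal (ε / 2) ≠ 0 := by simpa using hε
  obtain ⟨C, hCS, hC, hdiff⟩ :=
    hS.compl.exists_isCompact_sdiff_lt (μ := P + N) (measure_ne_top _ _) hδ
  have hNC : N C = 0 := measure_mono_null hCS hNS
  obtain ⟨U, hCU, hU, hUlt⟩ := C.exists_isOpen_lt_add (μ := P + N) (measure_ne_top _ _) hδ
  have hNU : N.real U < ε / 2 := by
    have hPU : P C ≤ P U := measure_mono hCU
    simp only [Measure.add_apply, hNC, add_zero] at hUlt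
    have h : N U < ENNReal.ofReal (ε / 2) := by
      by_contra! h
      exact absurd hUlt (not_lt.2 (add_le_add hPU h))
    exact (ENNReal.lt_ofReal_iff_toReal_lt (measure_ne_top _ _)).1 h
  have hPC : P.real Set.univ < P.real C + ε / 2 := by
    have h1 : P (Sᶜ \ C) < ENNReal.ofReal (ε / 2) :=
      (Measure.le_add_right le_rfl (Sᶜ \ C)).trans_lt hdiff
    have h2 : P.real (Sᶜ \ C) < ε / 2 :=
      (ENNReal.lt_ofReal_iff_toReal_lt (measure_ne_top _ _)).1 h1
    have h3 : P.real Sᶜ = P.real Set.univ := by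
      simp [measureReal_compl hS, measureReal_def, hPS]
    have h4 := measureReal_sdiff (μ := P) hCS hC.measurableSet
    linarith
  obtain ⟨f, hf0, hf1, hf⟩ := exists_continuous_zero_one_of_isClosed hU.isClosed_compl hC.isClosed
    (Set.disjoint_compl_left_iff_subset.2 hCU)
  have hint (Q : Measure K) [IsFiniteMeasure Q] : Integrable f Q :=
    f.continuous.integrable_of_hasCompactSupport (HasCompactSupport.of_compactSpace _)
  refine ⟨f, hf, ?_⟩
  have hP : P.real C ≤ ∫ t, f t ∂P := by
    rw [← integral_indicator_one hC.measurableSet]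
    refine integral_mono ((integrable_const 1).indicator hC.measurableSet) (hint P) fun t ↦ ?_
    by_cases ht : t ∈ C
    · simp [ht, hf1 ht]
    · simp [ht, (hf t).1]
  have hN : ∫ t, f t ∂N ≤ N.real U := by
    rw [← integral_indicator_one hU.measurableSet]
    refine integral_mono (hint N) ((integrable_const 1).indicator hU.measurableSet) fun t ↦ ?_
    by_cases ht : t ∈ U
    · simp [ht, (hf t).2]
    · simp [ht, hf0 (show t ∈ Uᶜ from ht)]
  linarith

theorem norm_sup_zero_add_norm_neg_sup_zero_le_one {K : Type*} [TopologicalSpace K]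
    [CompactSpace K] {f : C(K, ℝ)} (hf : ∀ t, 0 ≤ f t ∧ f t ≤ 1) :
    ‖f ⊔ 0‖ + ‖(-f) ⊔ 0‖ ≤ 1 := by
  have h1 : f ⊔ 0 = f := by ext t; simp [(hf t).1]
  have h2 : (-f) ⊔ 0 = 0 := by ext t; simp [(hf t).1]
  rw [h1, h2, norm_zero, add_zero, ContinuousMap.norm_le _ zero_le_one]
  intro t
  rw [Real.norm_eq_abs, abs_of_nonneg (hf t).1]
  exact (hf t).2

theorem abs_integral_sub_integral_le_max
    {K : Type*} [TopologicalSpace K] [CompactSpace K] [MeasurableSpace K] [BorelSpace K]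
    (P N : Measure K) [IsFiniteMeasure P] [IsFiniteMeasure N] {x : C(K, ℝ)}
    (hx : ‖x ⊔ 0‖ + ‖(-x) ⊔ 0‖ ≤ 1) :
    |(∫ t, x t ∂P) - ∫ t, x t ∂N| ≤ max (P.real Set.univ) (N.real Set.univ) := by
  have hle (t : K) : x t ≤ ‖x ⊔ 0‖ :=
    (le_max_left (x t) 0).trans ((le_abs_self _).trans ((x ⊔ 0).norm_coe_le_norm t))
  have hge (t : K) : -‖(-x) ⊔ 0‖ ≤ x t :=
    neg_le.1 ((le_max_left (-x t) 0).trans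
      ((le_abs_self _).trans (((-x) ⊔ 0).norm_coe_le_norm t)))
  have hint (Q : Measure K) [IsFiniteMeasure Q] :
      -(‖(-x) ⊔ 0‖ * Q.real Set.univ) ≤ ∫ t, x t ∂Q ∧
        ∫ t, x t ∂Q ≤ ‖x ⊔ 0‖ * Q.real Set.univ := by
    have hx : Integrable x Q :=
      x.continuous.integrable_of_hasCompactSupport (HasCompactSupport.of_compactSpace _)
    have h1 := integral_mono (integrable_const _) hx hge
    have h2 := integral_mono hx (integrable_const _) hle
    simp only [integral_const, smul_eq_mul] at h1 h2
    constructor <;> linarith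
  have hbound {a b : ℝ} (ha : 0 ≤ a) (hb : 0 ≤ b) (hab : a + b ≤ 1) :
      a * P.real Set.univ + b * N.real Set.univ ≤ max (P.real Set.univ) (N.real Set.univ) := by
    have h1 := mul_le_mul_of_nonneg_left (le_max_left (P.real Set.univ) (N.real Set.univ)) ha
    have h2 := mul_le_mul_of_nonneg_left (le_max_right (P.real Set.univ) (N.real Set.univ)) hb
    have h3 : 0 ≤ max (P.real Set.univ) (N.real Set.univ) := le_max_of_le_left measureReal_nonneg
    nlinarith
  have h1 := hbound (norm_nonneg _) (norm_nonneg _) hx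
  have h2 := hbound (norm_nonneg _) (norm_nonneg _) ((add_comm _ _).trans_le hx)
  obtain ⟨hP1, hP2⟩ := hint P
  obtain ⟨hN1, hN2⟩ := hint N
  rw [abs_le]
  constructor <;> linarith

/-- The dual norm of `‖·‖_d` on `C(K)` (where `‖x‖_d = ‖x⁺‖∞ + ‖x⁻‖∞`) is the norm
`‖μ‖₀ = max {μ⁺(K), μ⁻(K)}` on regular Borel signed measures: for every regular Borel
signed measure `μ` on a compact Hausdorff space `K`,
`sup { |∫ x dμ| : ‖x‖_d ≤ 1 } = max {μ⁺(K), μ⁻(K)}`. -/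
theorem dual_norm_of_d_norm_eq_norm_zero
    {K : Type*} [TopologicalSpace K] [CompactSpace K] [T2Space K]
    [MeasurableSpace K] [BorelSpace K]
    (μ : SignedMeasure K) (hreg : μ.totalVariation.Regular) :
    sSup {r : ℝ | ∃ x : C(K, ℝ), ‖x ⊔ 0‖ + ‖(-x) ⊔ 0‖ ≤ 1 ∧
        r = |(∫ t, x t ∂μ.toJordanDecomposition.posPart)
              - ∫ t, x t ∂μ.toJordanDecomposition.negPart|} =
      max (μ.toJordanDecomposition.posPart Set.univ).toReal
          (μ.toJordanDecomposition.negPart Set.univ).toReal := by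
  have hreg' : (μ.toJordanDecomposition.posPart + μ.toJordanDecomposition.negPart).Regular := hreg
  have hsing := μ.toJordanDecomposition.mutuallySingular
  generalize μ.toJordanDecomposition = j at hreg' hsing ⊢
  apply csSup_eq_of_forall_le_of_forall_lt_exists_gt
  · exact ⟨_, 0, by simp, rfl⟩
  · rintro r ⟨x, hx, rfl⟩
    exact abs_integral_sub_integral_le_max _ _ hx
  · intro w hw
    rcases lt_max_iff.1 hw with hw | hw
    · obtain ⟨f, hf, hlt⟩ := exists_continuousMap_lt_integral_sub_integral _ _ hsing hreg'
        (sub_pos.2 hw)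
      refine ⟨_, ⟨f, norm_sup_zero_add_norm_neg_sup_zero_le_one hf, rfl⟩, ?_⟩
      refine lt_of_lt_of_le ?_ (le_abs_self _)
      simpa [measureReal_def] using hlt
    · rw [add_comm] at hreg'
      obtain ⟨f, hf, hlt⟩ := exists_continuousMap_lt_integral_sub_integral _ _ hsing.symm hreg'
        (sub_pos.2 hw)
      refine ⟨_, ⟨f, norm_sup_zero_add_norm_neg_sup_zero_le_one hf, rfl⟩, ?_⟩
      rw [abs_sub_comm]
      refine lt_of_lt_of_le ?_ (le_abs_self _)
      simpa [measureReal_def] using hlt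
end

section
/- Let K be a compact Hausdorff space. A function x ∈ C(K) is an extreme point of the closed unit ball { y ∈ C(K) : ‖y‖_d ≤ 1 } if and only if x is not identically zero and either x(t) ∈ {0, 1} for every t ∈ K, or x(t) ∈ {−1, 0} for every t ∈ K. -/
theorem dNorm_le_one_iff {K : Type*} [TopologicalSpace K] [CompactSpace K] [Nonempty K]
    (y : C(K, ℝ)) :
    ‖y ⊔ 0‖ + ‖(-y) ⊔ 0‖ ≤ 1 ↔
      ∀ s t : K, y s ≤ 1 ∧ -1 ≤ y s ∧ y s - y t ≤ 1 := by
  constructor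
  · intro h s t
    have bound_pos : ∀ r : K, y r ≤ ‖y ⊔ 0‖ := fun r =>
      (le_max_left (y r) 0).trans ((le_abs_self _).trans ((y ⊔ 0).norm_coe_le_norm r))
    have bound_neg : ∀ r : K, -y r ≤ ‖(-y) ⊔ 0‖ := fun r =>
      (le_max_left (-y r) 0).trans ((le_abs_self _).trans (((-y) ⊔ 0).norm_coe_le_norm r))
    have := bound_pos s
    have := bound_neg s
    have := bound_neg t
    have := norm_nonneg (y ⊔ 0)
    have := norm_nonneg ((-y) ⊔ 0)
    refine ⟨?_, ?_, ?_⟩ <;> linarith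
  · intro h
    rw [← le_sub_iff_add_le, ContinuousMap.norm_le_of_nonempty]
    intro s
    rw [le_sub_comm, ContinuousMap.norm_le_of_nonempty]
    intro t
    change |max (-y t) 0| ≤ 1 - |max (y s) 0|
    rw [abs_of_nonneg (le_max_right _ _), abs_of_nonneg (le_max_right _ _)]
    obtain ⟨h₁, -, h₂⟩ := h s t
    obtain ⟨-, h₃, -⟩ := h t s
    refine max_le ?_ ?_
    · rw [le_sub_comm]
      exact max_le (by linarith) (by linarith)
    · rw [le_sub_comm]
      exact max_le (by linarith) (by linarith)

theorem eq_zero_of_mem_extremePoints_of_add_sub_mem {E : Type*} [AddCommGroup E] [Module ℝ E]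
    {A : Set E} {x h : E} (hx : x ∈ A.extremePoints ℝ) (hadd : x + h ∈ A) (hsub : x - h ∈ A) :
    h = 0 := by
  have hseg : x ∈ openSegment ℝ (x + h) (x - h) :=
    ⟨1 / 2, 1 / 2, by norm_num, by norm_num, by norm_num, by module⟩
  simpa using hx.2 hadd hsub hseg

theorem mem_extremePoints_dNorm_ball_of_forall_eq_zero_or_one
    {K : Type*} [TopologicalSpace K] [CompactSpace K] [Nonempty K] {x : C(K, ℝ)}
    (hne : x ≠ 0) (hx : ∀ t, x t = 0 ∨ x t = 1) :
    x ∈ Set.extremePoints ℝ {y : C(K, ℝ) | ‖y ⊔ 0‖ + ‖(-y) ⊔ 0‖ ≤ 1} := by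
  refine ⟨(dNorm_le_one_iff x).2 fun s t => ?_, ?_⟩
  · rcases hx s with hs | hs <;> rcases hx t with ht | ht <;> rw [hs, ht] <;> norm_num
  rintro u hu v hv ⟨a, b, ha, hb, hab, rfl⟩
  replace hu := (dNorm_le_one_iff u).1 hu
  replace hv := (dNorm_le_one_iff v).1 hv
  have eq_one : ∀ t, a * u t + b * v t = 1 → u t = 1 ∧ v t = 1 := by
    intro t ht
    have h₁ := (hu t t).1
    have h₂ := (hv t t).1
    constructor <;> nlinarith
  obtain ⟨t₀, ht₀⟩ := DFunLike.ne_iff.1 hne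
  obtain ⟨hu₀, hv₀⟩ := eq_one t₀ ((hx t₀).resolve_left ht₀)
  ext t
  change u t = a * u t + b * v t
  rcases hx t with ht | ht
  · change a * u t + b * v t = 0 at ht
    have h₁ := (hu t₀ t).2.2
    have h₂ := (hv t₀ t).2.2
    nlinarith
  · change a * u t + b * v t = 1 at ht
    rw [ht, (eq_one t ht).1]

theorem neg_mem_extremePoints_dNorm_ball
    {K : Type*} [TopologicalSpace K] [CompactSpace K] {x : C(K, ℝ)}
    (hx : x ∈ Set.extremePoints ℝ {y : C(K, ℝ) | ‖y ⊔ 0‖ + ‖(-y) ⊔ 0‖ ≤ 1}) :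
    -x ∈ Set.extremePoints ℝ {y : C(K, ℝ) | ‖y ⊔ 0‖ + ‖(-y) ⊔ 0‖ ≤ 1} := by
  have neg_mem : ∀ y ∈ {y : C(K, ℝ) | ‖y ⊔ 0‖ + ‖(-y) ⊔ 0‖ ≤ 1},
      -y ∈ {y : C(K, ℝ) | ‖y ⊔ 0‖ + ‖(-y) ⊔ 0‖ ≤ 1} := by
    intro y hy
    simpa [add_comm] using hy
  refine ⟨neg_mem x hx.1, ?_⟩
  rintro u hu v hv ⟨a, b, ha, hb, hab, h⟩
  rw [← hx.2 (neg_mem u hu) (neg_mem v hv)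
    ⟨a, b, ha, hb, hab, by rw [← neg_neg x, ← h]; module⟩, neg_neg]

theorem eq_zero_or_one_of_mem_extremePoints_dNorm_ball
    {K : Type*} [TopologicalSpace K] [CompactSpace K] [Nonempty K] {x : C(K, ℝ)}
    (hx : x ∈ Set.extremePoints ℝ {y : C(K, ℝ) | ‖y ⊔ 0‖ + ‖(-y) ⊔ 0‖ ≤ 1})
    (hpos : ∀ t, 0 ≤ x t) (t : K) : x t = 0 ∨ x t = 1 := by
  have hle : ∀ t, x t ≤ 1 := fun t => ((dNorm_le_one_iff x).1 hx.1 t t).1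
  have mem_of_unit : ∀ y : C(K, ℝ), (∀ t, 0 ≤ y t ∧ y t ≤ 1) →
      y ∈ {y : C(K, ℝ) | ‖y ⊔ 0‖ + ‖(-y) ⊔ 0‖ ≤ 1} := by
    intro y hy
    refine (dNorm_le_one_iff y).2 fun s t => ⟨(hy s).2, ?_, ?_⟩
    · linarith [(hy s).1]
    · linarith [(hy s).2, (hy t).1]
  have h := eq_zero_of_mem_extremePoints_of_add_sub_mem (h := x * (1 - x)) hx
    (mem_of_unit _ fun t => by
      change 0 ≤ x t + x t * (1 - x t) ∧ x t + x t * (1 - x t) ≤ 1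
      constructor <;> nlinarith [hpos t, hle t])
    (mem_of_unit _ fun t => by
      change 0 ≤ x t - x t * (1 - x t) ∧ x t - x t * (1 - x t) ≤ 1
      constructor <;> nlinarith [hpos t, hle t])
  have ht : x t * (1 - x t) = 0 := DFunLike.congr_fun h t
  exact (mul_eq_zero.1 ht).imp_right fun h => (sub_eq_zero.1 h).symm

theorem nonneg_or_nonpos_of_mem_extremePoints_dNorm_ball
    {K : Type*} [TopologicalSpace K] [CompactSpace K] [Nonempty K] {x : C(K, ℝ)}
    (hx : x ∈ Set.extremePoints ℝ {y : C(K, ℝ) | ‖y ⊔ 0‖ + ‖(-y) ⊔ 0‖ ≤ 1}) :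
    (∀ t, 0 ≤ x t) ∨ (∀ t, x t ≤ 0) := by
  by_contra! hcon
  obtain ⟨⟨t, ht⟩, s, hs⟩ := hcon
  have hmem := (dNorm_le_one_iff x).1 hx.1
  set ε := min (x s) (-x t)
  have hε : 0 < ε := lt_min hs (by linarith)
  have hεs : ε ≤ x s := min_le_left _ _
  have hεt : ε ≤ -x t := min_le_right _ _
  have h := eq_zero_of_mem_extremePoints_of_add_sub_mem (h := ContinuousMap.const K ε) hx
    ((dNorm_le_one_iff _).2 fun p q => by
      change x p + ε ≤ 1 ∧ -1 ≤ x p + ε ∧ (x p + ε) - (x q + ε) ≤ 1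
      refine ⟨?_, ?_, ?_⟩ <;> linarith [(hmem p t).2.2, (hmem p q).2.1, (hmem p q).2.2])
    ((dNorm_le_one_iff _).2 fun p q => by
      change x p - ε ≤ 1 ∧ -1 ≤ x p - ε ∧ (x p - ε) - (x q - ε) ≤ 1
      refine ⟨?_, ?_, ?_⟩ <;> linarith [(hmem s p).2.2, (hmem p q).1, (hmem p q).2.2])
  exact hε.ne' (DFunLike.congr_fun h t)


/-- A function `x ∈ C(K)` (`K` a nonempty compact Hausdorff space) is an extreme point
of the closed unit ball of `(C(K), ‖·‖_d)`, where `‖y‖_d = ‖y⁺‖∞ + ‖y⁻‖∞`, if and only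
if `x ≠ 0` and either `x` takes only the values `0` and `1`, or `x` takes only the
values `-1` and `0`. -/
theorem extreme_points_of_d_norm_ball
    {K : Type*} [TopologicalSpace K] [CompactSpace K] [T2Space K] [Nonempty K]
    (x : C(K, ℝ)) :
    x ∈ Set.extremePoints ℝ {y : C(K, ℝ) | ‖y ⊔ 0‖ + ‖(-y) ⊔ 0‖ ≤ 1} ↔
      x ≠ 0 ∧
        ((∀ t : K, x t = 0 ∨ x t = 1) ∨ (∀ t : K, x t = -1 ∨ x t = 0)) := by
  constructor
  · intro hx
    refine ⟨?_, ?_⟩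
    · rintro rfl
      have h := eq_zero_of_mem_extremePoints_of_add_sub_mem (h := (1 : C(K, ℝ))) hx
        ((dNorm_le_one_iff _).2 fun s t => by simp)
        ((dNorm_le_one_iff _).2 fun s t => by simp)
      exact one_ne_zero h
    · rcases nonneg_or_nonpos_of_mem_extremePoints_dNorm_ball hx with h | h
      · exact Or.inl (eq_zero_or_one_of_mem_extremePoints_dNorm_ball hx h)
      · refine Or.inr fun t => ?_
        rcases eq_zero_or_one_of_mem_extremePoints_dNorm_ball
          (neg_mem_extremePoints_dNorm_ball hx) (fun t => neg_nonneg.2 (h t)) t with ht | ht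
        · exact Or.inr (neg_eq_zero.1 ht)
        · exact Or.inl (neg_eq_iff_eq_neg.1 ht)
  · rintro ⟨hne, h | h⟩
    · exact mem_extremePoints_dNorm_ball_of_forall_eq_zero_or_one hne h
    · rw [← neg_neg x]
      refine neg_mem_extremePoints_dNorm_ball
        (mem_extremePoints_dNorm_ball_of_forall_eq_zero_or_one (neg_ne_zero.2 hne) fun t => ?_)
      exact (h t).symm.imp neg_eq_zero.2 neg_eq_iff_eq_neg.2
end

section
/- Let K and L be compact Hausdorff spaces having no isolated points, and let T : C(K) → C(L) be a linear bijection that is isometric for the norms ‖·‖_d, i.e. ‖(Tx)⁺‖∞ + ‖(Tx)⁻‖∞ = ‖x⁺‖∞ + ‖x⁻‖∞ for every x ∈ C(K). Then there exists a homeomorphism φ : L → K such that either (Tx)(s) = x(φ(s)) for all x ∈ C(K) and s ∈ L, or (Tx)(s) = −x(φ(s)) for all x ∈ C(K) and s ∈ L. -/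
/-- The extension of a continuous function on `K` by zero to `K` with an isolated point added. -/
def extendZero {K : Type*} [TopologicalSpace K] : C(K, ℝ) →ₗ[ℝ] C(K ⊕ Unit, ℝ) where
  toFun x := ⟨Sum.elim x fun _ => 0, x.continuous.sumElim continuous_const⟩
  map_add' x y := by ext p; rcases p with p | p <;> simp
  map_smul' c x := by ext p; rcases p with p | p <;> simp

@[simp]
lemma extendZero_inl {K : Type*} [TopologicalSpace K] (x : C(K, ℝ)) (k : K) :
    extendZero x (Sum.inl k) = x k := rfl

@[simp]
lemma extendZero_inr {K : Type*} [TopologicalSpace K] (x : C(K, ℝ)) (u : Unit) :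
    extendZero x (Sum.inr u) = 0 := rfl

/-- The norm `‖x‖_d = ‖x⁺‖ + ‖x⁻‖`. -/
noncomputable def dNorm {K : Type*} [TopologicalSpace K] [CompactSpace K] (x : C(K, ℝ)) : ℝ :=
  ‖x ⊔ 0‖ + ‖(-x) ⊔ 0‖

section DNorm

variable {K : Type*} [TopologicalSpace K] [CompactSpace K]

lemma extendZero_le_norm_sup (x : C(K, ℝ)) (p : K ⊕ Unit) : extendZero x p ≤ ‖x ⊔ 0‖ := by
  rcases p with k | u
  · exact (le_max_left (x k) 0).trans ((le_abs_self _).trans ((x ⊔ 0).norm_coe_le_norm k))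
  · exact norm_nonneg _

lemma exists_extendZero_eq_norm_sup (x : C(K, ℝ)) : ∃ p, extendZero x p = ‖x ⊔ 0‖ := by
  obtain ⟨p, -, hp⟩ := isCompact_univ.exists_isMaxOn ⟨Sum.inr (), Set.mem_univ _⟩
    (extendZero x).continuous.continuousOn
  have hmax : ∀ q, extendZero x q ≤ extendZero x p := fun q => hp (Set.mem_univ q)
  have hpos : 0 ≤ extendZero x p := hmax (Sum.inr ())
  refine ⟨p, le_antisymm (extendZero_le_norm_sup x p) ?_⟩
  refine (ContinuousMap.norm_le _ hpos).2 fun k => ?_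
  rw [Real.norm_eq_abs, abs_of_nonneg (show 0 ≤ (x ⊔ 0) k from le_max_right (x k) 0)]
  exact max_le (hmax (Sum.inl k)) hpos

lemma extendZero_sub_le_dNorm (x : C(K, ℝ)) (p q : K ⊕ Unit) :
    extendZero x p - extendZero x q ≤ dNorm x := by
  have h₁ := extendZero_le_norm_sup x p
  have h₂ := extendZero_le_norm_sup (-x) q
  rw [map_neg, ContinuousMap.neg_apply] at h₂
  rw [dNorm]
  linarith

lemma exists_extendZero_sub_eq_dNorm (x : C(K, ℝ)) :
    ∃ p q, extendZero x p - extendZero x q = dNorm x := by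
  obtain ⟨p, hp⟩ := exists_extendZero_eq_norm_sup x
  obtain ⟨q, hq⟩ := exists_extendZero_eq_norm_sup (-x)
  rw [map_neg, ContinuousMap.neg_apply] at hq
  exact ⟨p, q, by rw [dNorm]; linarith⟩

lemma dNorm_eq_of_forall_le {x : C(K, ℝ)} {s t : K ⊕ Unit}
    (hs : ∀ p, extendZero x p ≤ extendZero x s) (ht : ∀ p, extendZero x t ≤ extendZero x p) :
    extendZero x s - extendZero x t = dNorm x := by
  obtain ⟨p, q, h⟩ := exists_extendZero_sub_eq_dNorm x
  linarith [hs p, ht q, extendZero_sub_le_dNorm x s t]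

/-- Every function is a difference of two functions attaining their norm `dNorm` at a given pair
of distinct points. -/
lemma exists_attaining_dNorm [T2Space K] {s t : K ⊕ Unit} (hst : s ≠ t) (x : C(K, ℝ)) :
    ∃ z : C(K, ℝ), extendZero z s - extendZero z t = dNorm z ∧
      extendZero (x + z) s - extendZero (x + z) t = dNorm (x + z) := by
  obtain ⟨u, hut, hus, hu⟩ := exists_continuous_zero_one_of_isClosed (isClosed_singleton (x := t))
    (isClosed_singleton (x := s)) (by simpa using hst.symm)
  replace hut : u t = 0 := hut rfl
  replace hus : u s = 1 := hus rfl
  set f : C(K ⊕ Unit, ℝ) := extendZero x with hf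
  set M : ℝ := 2 * ‖f‖
  have hfM : ∀ p q, |f p - f q| ≤ M := fun p q => by
    have hp := abs_le.1 (f.norm_coe_le_norm p)
    have hq := abs_le.1 (f.norm_coe_le_norm q)
    rw [abs_le]
    constructor <;> linarith
  let Y : K ⊕ Unit → ℝ := fun p =>
    M * (2 * u p - 1) - |f p - f s| * u p + |f p - f t| * (1 - u p)
  have hY : Continuous Y := by fun_prop
  let z : C(K, ℝ) := ⟨fun k => Y (Sum.inl k) - Y (Sum.inr ()), by fun_prop⟩
  have hz : ∀ p, extendZero z p = Y p - Y (Sum.inr ()) := by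
    rintro (k | v)
    · rfl
    · simp
  have hYs : Y s = M := by simp only [Y, hus]; simp; ring
  have hYt : Y t = -M := by simp only [Y, hut]; simp
  have hbound : ∀ p, Y p ≤ M ∧ -M ≤ Y p ∧ f p + Y p ≤ f s + M ∧ f t - M ≤ f p + Y p := by
    intro p
    obtain ⟨h0, h1⟩ := hu p
    have h1' : 0 ≤ 1 - u p := by linarith
    have a1 := mul_nonneg (abs_nonneg (f p - f s)) h0
    have a2 := mul_nonneg (abs_nonneg (f p - f t)) h1'
    have b1 := mul_le_mul_of_nonneg_right (hfM p s) h0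
    have b2 := mul_le_mul_of_nonneg_right (hfM p t) h1'
    have b1' := mul_le_mul_of_nonneg_right (hfM p s) h1'
    have b2' := mul_le_mul_of_nonneg_right (hfM p t) h0
    have c1 := mul_le_mul_of_nonneg_right (le_abs_self (f p - f s)) h0
    have c2 := mul_le_mul_of_nonneg_right (le_abs_self (f p - f s)) h1'
    have d1 := mul_le_mul_of_nonneg_right (neg_abs_le (f p - f t)) h0
    have d2 := mul_le_mul_of_nonneg_right (neg_abs_le (f p - f t)) h1'
    have hM : 0 ≤ M := (abs_nonneg _).trans (hfM s t)
    have e1 := mul_nonneg hM h0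
    have e2 := mul_nonneg hM h1'
    refine ⟨?_, ?_, ?_, ?_⟩ <;> simp only [Y] <;> nlinarith
  refine ⟨z, dNorm_eq_of_forall_le (fun p => ?_) (fun p => ?_),
    dNorm_eq_of_forall_le (fun p => ?_) (fun p => ?_)⟩ <;>
  simp only [map_add, ContinuousMap.add_apply, hz, ← hf, hYs, hYt] <;>
  linarith [hbound p]

end DNorm

section Isometry

variable {K L : Type*} [TopologicalSpace K] [CompactSpace K]
  [TopologicalSpace L] [CompactSpace L] [T2Space L]

/-- The transpose of a surjective `dNorm`-isometry maps differences of distinct point evaluations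
to differences of point evaluations. -/
lemma exists_extendZero_sub_eq (T : C(K, ℝ) →ₗ[ℝ] C(L, ℝ)) (hsurj : Function.Surjective T)
    (hiso : ∀ x, dNorm (T x) = dNorm x) {s t : L ⊕ Unit} (hst : s ≠ t) :
    ∃ p q, ∀ x, extendZero (T x) s - extendZero (T x) t = extendZero x p - extendZero x q := by
  let A : Set C(K, ℝ) := {x | extendZero (T x) s - extendZero (T x) t = dNorm (T x)}
  let F : A → Set ((K ⊕ Unit) × (K ⊕ Unit)) :=
    fun x => {r | extendZero x.1 r.1 - extendZero x.1 r.2 = dNorm x.1}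
  have hclosed : ∀ x, IsClosed (F x) := fun x => isClosed_eq (by fun_prop) continuous_const
  have hdir : Directed (· ⊇ ·) F := by
    rintro ⟨x, hx⟩ ⟨y, hy⟩
    have hsum : dNorm (T x) + dNorm (T y) ≤ dNorm (T (x + y)) := by
      have h := extendZero_sub_le_dNorm (T (x + y)) s t
      simp only [map_add, ContinuousMap.add_apply] at h ⊢
      rw [← hx, ← hy]
      linarith
    have hxy : x + y ∈ A := by
      refine le_antisymm (extendZero_sub_le_dNorm _ s t) ?_
      obtain ⟨p, q, h⟩ := exists_extendZero_sub_eq_dNorm (T (x + y))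
      have h₁ := extendZero_sub_le_dNorm (T x) p q
      have h₂ := extendZero_sub_le_dNorm (T y) p q
      rw [← h]
      rw [← show _ = _ from hx] at h₁
      rw [← show _ = _ from hy] at h₂
      simp only [map_add, ContinuousMap.add_apply]
      linarith
    rw [hiso, hiso, hiso] at hsum
    refine ⟨⟨x + y, hxy⟩, ?_, ?_⟩ <;>
    · rintro ⟨p, q⟩ (h : extendZero (x + y) p - extendZero (x + y) q = dNorm (x + y))
      have h₁ := extendZero_sub_le_dNorm x p q
      have h₂ := extendZero_sub_le_dNorm y p q
      simp only [map_add, ContinuousMap.add_apply] at h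
      simp only [F, Set.mem_ofPred_eq]
      linarith
  have : Nonempty A := ⟨⟨0, by simp [A, dNorm]⟩⟩
  obtain ⟨⟨p, q⟩, hpq⟩ := IsCompact.nonempty_iInter_of_directed_nonempty_isCompact_isClosed F hdir
    (fun x => by
      obtain ⟨p, q, h⟩ := exists_extendZero_sub_eq_dNorm x.1
      exact ⟨(p, q), h⟩)
    (fun x => (hclosed x).isCompact) hclosed
  have hA : ∀ x ∈ A, extendZero (T x) s - extendZero (T x) t
      = extendZero x p - extendZero x q := fun x hx => by
    have h : extendZero x p - extendZero x q = dNorm x := Set.mem_iInter.1 hpq ⟨x, hx⟩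
    rw [h, ← hiso]
    exact hx
  refine ⟨p, q, fun x => ?_⟩
  obtain ⟨z, hz, hxz⟩ := exists_attaining_dNorm hst (T x)
  obtain ⟨w, rfl⟩ := hsurj z
  have h₁ := hA w hz
  have h₂ := hA (x + w) (by simpa only [A, Set.mem_ofPred_eq, map_add] using hxz)
  simp only [map_add, ContinuousMap.add_apply] at h₂
  linarith

lemma apply_one_sub_apply_one_le (T : C(K, ℝ) →ₗ[ℝ] C(L, ℝ)) (hsurj : Function.Surjective T)
    (hiso : ∀ x, dNorm (T x) = dNorm x) (a b : L) :
    T 1 a - T 1 b ≤ 1 := by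
  rcases eq_or_ne a b with rfl | hab
  · simp
  obtain ⟨p, q, h⟩ := exists_extendZero_sub_eq T hsurj hiso (Sum.inl_injective.ne hab)
  have h1 := h 1
  rcases p with p | p <;> rcases q with q | q <;> simp at h1 <;> linarith

end Isometry

section PointEvaluations

variable {K L : Type*} [TopologicalSpace K] [CompactSpace K] [T2Space K]
  [TopologicalSpace L] [CompactSpace L] [T2Space L]

/-- In a compact Hausdorff space, an identity between sums of two point evaluations forces the
points to agree. -/
lemma eq_of_forall_apply_add_eq {s t k p : K} (hst : s ≠ t)
    (h : ∀ x : C(K, ℝ), x k + x t = x s + x p) : k = s := by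
  by_contra hk
  obtain ⟨x, hx0, hx1, hx⟩ := exists_continuous_zero_one_of_isClosed
    (s := {k, t}) (t := {s}) (Set.toFinite _).isClosed isClosed_singleton
    (by simp [Set.disjoint_singleton_right, Ne.symm hk, hst])
  have hxk : x k = 0 := hx0 (by simp)
  have hxt : x t = 0 := hx0 (by simp)
  have hxs : x s = 1 := hx1 rfl
  linarith [h x, (hx p).1]

lemma exists_apply_eq_of_apply_one_ne_neg_one (hL : ∀ s : L, ¬ IsOpen ({s} : Set L))
    (T : C(K, ℝ) →ₗ[ℝ] C(L, ℝ)) (hbij : Function.Bijective T)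
    (hiso : ∀ x, dNorm (T x) = dNorm x) (hne : ∀ a, T 1 a ≠ -1) (a : L) :
    ∃ k, ∀ x, T x a = x k := by
  have hone : ∀ c, ∃ x, T x c = 1 := fun c => by
    obtain ⟨x, hx⟩ := hbij.2 1
    exact ⟨x, by rw [hx]; rfl⟩
  have hpair : ∀ c, (T 1 c = 1 ∧ ∃ k, ∀ x, T x c = x k) ∨
      (T 1 c = 0 ∧ ∃ k l, k ≠ l ∧ ∀ x, T x c = x k - x l) := by
    intro c
    obtain ⟨p, q, h⟩ := exists_extendZero_sub_eq T hbij.2 hiso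
      (Sum.inl_ne_inr (a := c) (b := ()))
    simp only [extendZero_inl, extendZero_inr, sub_zero] at h
    obtain ⟨x, hx⟩ := hone c
    rcases p with p | p <;> rcases q with q | q <;>
      simp only [extendZero_inl, extendZero_inr, sub_zero, zero_sub] at h
    · refine Or.inr ⟨by simp [h 1], p, q, ?_, h⟩
      rintro rfl
      simp [h x] at hx
    · exact Or.inl ⟨by simp [h 1], p, h⟩
    · exact absurd (by simp [h 1]) (hne c)
    · simp [h x] at hx
  rcases hpair a with ⟨-, h⟩ | ⟨ha, s, t, hst, hT⟩
  · exact h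
  exfalso
  obtain ⟨b, hb⟩ : ∃ b, T 1 b = 1 := by
    by_contra! hno
    have h0 : T 1 = 0 := by
      ext c
      exact ((hpair c).resolve_left fun h => hno c h.1).1
    have h1 : (1 : C(K, ℝ)) s = 0 := by
      rw [hbij.1 (h0.trans (map_zero T).symm)]; rfl
    simp at h1
  obtain ⟨b', hb', hbb'⟩ : ∃ b', T 1 b' = 1 ∧ b' ≠ b := by
    by_contra! hno
    refine hL b ?_
    have hopen : IsOpen {c | 0 < T 1 c} := isOpen_lt continuous_const (T 1).continuous
    convert hopen using 1
    ext c
    constructor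
    · rintro rfl
      simp [hb]
    · intro (hc : 0 < T 1 c)
      rcases hpair c with h | h
      · exact hno c h.1
      · linarith [h.1]
  have hpoint : ∀ c, T 1 c = 1 → ∀ x, T x c = x s := by
    intro c hc
    obtain ⟨k, hk⟩ : ∃ k, ∀ x, T x c = x k := by
      rcases hpair c with h | h
      · exact h.2
      · linarith [h.1]
    have hca : c ≠ a := by
      rintro rfl
      linarith
    obtain ⟨p, q, h⟩ := exists_extendZero_sub_eq T hbij.2 hiso (Sum.inl_injective.ne hca)
    simp only [extendZero_inl] at h
    have h1 := h 1
    rw [hc, ha] at h1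
    rcases p with p | p <;> rcases q with q | q <;> norm_num at h1
    have hks : k = s := eq_of_forall_apply_add_eq (p := p) hst fun x => by
      have hx := h x
      rw [hk, hT, extendZero_inl, extendZero_inr] at hx
      linarith
    exact hks ▸ hk
  obtain ⟨y, hy0, hy1, -⟩ := exists_continuous_zero_one_of_isClosed
    (isClosed_singleton (x := b)) (isClosed_singleton (x := b')) (by simpa using hbb'.symm)
  obtain ⟨x, rfl⟩ := hbij.2 y
  have h0 : T x b = 0 := hy0 rfl
  have h1 : T x b' = 1 := hy1 rfl
  rw [hpoint b hb] at h0
  rw [hpoint b' hb'] at h1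
  linarith

/-- A linear bijection which transposes point evaluations to point evaluations is the composition
with a homeomorphism. -/
lemma exists_homeomorph_of_forall_exists_apply_eq (T : C(K, ℝ) →ₗ[ℝ] C(L, ℝ))
    (hbij : Function.Bijective T) (h : ∀ a, ∃ k, ∀ x, T x a = x k) :
    ∃ φ : L ≃ₜ K, ∀ x s, T x s = x (φ s) := by
  choose φ hφ using fun a => h a
  have hcont : Continuous φ := by
    rw [continuous_iff_continuousAt]
    intro a
    rw [ContinuousAt, Filter.tendsto_def]
    intro U hU
    obtain ⟨x, hx0, hx1, -⟩ := exists_continuous_zero_one_of_isClosed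
      (isClosed_singleton (x := φ a)) (isOpen_interior (s := U)).isClosed_compl
      (by simpa using mem_interior_iff_mem_nhds.2 hU)
    have ha : T x a < 1 := by
      rw [hφ, show x (φ a) = 0 from hx0 rfl]
      exact one_pos
    filter_upwards [(T x).continuous.continuousAt.eventually_lt continuousAt_const ha] with b hb
    by_contra hbU
    have hbi : φ b ∉ interior U := fun hi => hbU (show φ b ∈ U from interior_subset hi)
    rw [hφ, show x (φ b) = 1 from hx1 hbi] at hb
    exact lt_irrefl _ hb
  have hinj : Function.Injective φ := by
    intro a b hab
    by_contra hne
    obtain ⟨y, hy0, hy1, -⟩ := exists_continuous_zero_one_of_isClosed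
      (isClosed_singleton (x := a)) (isClosed_singleton (x := b)) (by simpa using hne)
    obtain ⟨x, rfl⟩ := hbij.2 y
    have h0 : T x a = 0 := hy0 rfl
    have h1 : T x b = 1 := hy1 rfl
    rw [hφ, hab] at h0
    rw [hφ] at h1
    linarith
  have hsurj : Function.Surjective φ := by
    by_contra hns
    obtain ⟨k, hk⟩ := not_forall.1 hns
    obtain ⟨x, hx0, hx1, -⟩ := exists_continuous_zero_one_of_isClosed
      (isCompact_range hcont).isClosed (isClosed_singleton (x := k)) (by simpa using hk)
    have hTx : T x = 0 := by
      ext a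
      rw [hφ]
      exact hx0 ⟨a, rfl⟩
    have hxk : x k = 1 := hx1 rfl
    rw [hbij.1 (hTx.trans (map_zero T).symm)] at hxk
    simp at hxk
  exact ⟨(Equiv.ofBijective φ ⟨hinj, hsurj⟩).toHomeomorphOfIsInducing
    (hcont.isClosedEmbedding hinj).isInducing, fun x s => hφ s x⟩

end PointEvaluations

/-- **Banach–Stone theorem for the norm `‖·‖_d`.** If `K` and `L` are compact Hausdorff
spaces without isolated points and `T : C(K) → C(L)` is a linear bijection that is
isometric for the norms `‖x‖_d = ‖x⁺‖∞ + ‖x⁻‖∞`, then there is a homeomorphism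
`φ : L ≃ₜ K` with `T x = x ∘ φ` for all `x`, or `T x = -(x ∘ φ)` for all `x`. -/
theorem banach_stone_for_d_norm
    {K L : Type*} [TopologicalSpace K] [CompactSpace K] [T2Space K]
    [TopologicalSpace L] [CompactSpace L] [T2Space L]
    (hK : ∀ t : K, ¬ IsOpen ({t} : Set K)) (hL : ∀ s : L, ¬ IsOpen ({s} : Set L))
    (T : C(K, ℝ) →ₗ[ℝ] C(L, ℝ)) (hbij : Function.Bijective T)
    (hiso : ∀ x : C(K, ℝ),
      ‖(T x) ⊔ 0‖ + ‖(-(T x)) ⊔ 0‖ = ‖x ⊔ 0‖ + ‖(-x) ⊔ 0‖) :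
    ∃ φ : L ≃ₜ K,
      (∀ (x : C(K, ℝ)) (s : L), T x s = x (φ s)) ∨
      (∀ (x : C(K, ℝ)) (s : L), T x s = -(x (φ s))) := by
  by_cases hne : ∀ a, T 1 a ≠ -1
  · obtain ⟨φ, hφ⟩ := exists_homeomorph_of_forall_exists_apply_eq T hbij
      (exists_apply_eq_of_apply_one_ne_neg_one hL T hbij hiso hne)
    exact ⟨φ, Or.inl hφ⟩
  · obtain ⟨b, hb⟩ := not_forall_not.1 hne
    have hbij' : Function.Bijective (-T) := (Equiv.neg C(L, ℝ)).bijective.comp hbij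
    have hiso' : ∀ x, dNorm ((-T) x) = dNorm x := fun x => by
      rw [← show dNorm (T x) = dNorm x from hiso x, LinearMap.neg_apply, dNorm, dNorm, neg_neg,
        add_comm]
    obtain ⟨φ, hφ⟩ := exists_homeomorph_of_forall_exists_apply_eq (-T) hbij'
      (exists_apply_eq_of_apply_one_ne_neg_one hL (-T) hbij' hiso' fun a ha => by
        have h := apply_one_sub_apply_one_le T hbij.2 hiso a b
        rw [LinearMap.neg_apply, ContinuousMap.neg_apply] at ha
        linarith)
    refine ⟨φ, Or.inr fun x s => ?_⟩
    rw [← hφ, LinearMap.neg_apply, ContinuousMap.neg_apply, neg_neg]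
end

section
/- Let K be a compact Hausdorff space and t ∈ K. There exists a continuous function x : K → ℝ that peaks at t, i.e. x(s) < x(t) for every s ∈ K with s ≠ t, if and only if the singleton {t} is a Gδ subset of K. -/
/-- On a compact Hausdorff space `K`, there is a continuous real function peaking at
`t ∈ K` (i.e. `x s < x t` for all `s ≠ t`) if and only if `{t}` is a `Gδ` set. -/
theorem exists_peak_function_iff_Gdelta
    {K : Type*} [TopologicalSpace K] [CompactSpace K] [T2Space K] (t : K) :
    (∃ x : C(K, ℝ), ∀ s : K, s ≠ t → x s < x t) ↔ IsGδ ({t} : Set K) := by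
  constructor
  · rintro ⟨x, hx⟩
    have h : ({t} : Set K) = x ⁻¹' {x t} := by
      ext s
      refine ⟨fun hs => congrArg x hs, fun hs => ?_⟩
      by_contra hne
      exact (hx s hne).ne hs
    rw [h]
    exact (IsGδ.singleton (x t)).preimage x.continuous
  · intro h
    obtain ⟨f, hf, -, -, hf_range⟩ := exists_continuous_one_zero_of_isCompact_of_isGδ
      isCompact_singleton h isClosed_empty (Set.disjoint_empty _)
    have hft : f t = 1 := hf.subset (Set.mem_singleton t)
    refine ⟨f, fun s hs => ?_⟩
    rw [hft]
    exact (hf_range s).2.lt_of_ne fun hfs => hs (hf.superset hfs)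
end

section
/- Let K be a compact Hausdorff space and let t, s ∈ K with t ≠ s. There exists x ∈ C(K) with x(t) = 1/2, x(s) = −1/2, and −1/2 < x(u) < 1/2 for every u ∈ K \ {t, s}, if and only if both singletons {t} and {s} are Gδ subsets of K. -/
/-- On a compact Hausdorff space `K`, for distinct points `t, s ∈ K` there is
`x ∈ C(K)` with `x t = 1/2`, `x s = -1/2` and `-1/2 < x u < 1/2` for all other `u`
if and only if both `{t}` and `{s}` are `Gδ` sets. -/
theorem exists_two_point_peak_function_iff_Gdelta
    {K : Type*} [TopologicalSpace K] [CompactSpace K] [T2Space K]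
    (t s : K) (hts : t ≠ s) :
    (∃ x : C(K, ℝ), x t = 1 / 2 ∧ x s = -(1 / 2) ∧
        ∀ u : K, u ≠ t → u ≠ s → -(1 / 2) < x u ∧ x u < 1 / 2) ↔
      (IsGδ ({t} : Set K) ∧ IsGδ ({s} : Set K)) := by
  constructor
  · rintro ⟨x, hxt, hxs, hx⟩
    have ht : ({t} : Set K) = x ⁻¹' {1 / 2} := by
      ext u
      simp only [Set.mem_singleton_iff, Set.mem_preimage]
      refine ⟨fun h => h ▸ hxt, fun h => ?_⟩
      by_contra hut
      by_cases hus : u = s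
      · subst hus
        linarith
      · linarith [(hx u hut hus).2]
    have hs : ({s} : Set K) = x ⁻¹' {-(1 / 2)} := by
      ext u
      simp only [Set.mem_singleton_iff, Set.mem_preimage]
      refine ⟨fun h => h ▸ hxs, fun h => ?_⟩
      by_contra hus
      by_cases hut : u = t
      · subst hut
        linarith
      · linarith [(hx u hut hus).1]
    rw [ht, hs]
    exact ⟨isClosed_singleton.isGδ.preimage x.continuous,
      isClosed_singleton.isGδ.preimage x.continuous⟩
  · rintro ⟨ht, hs⟩
    obtain ⟨f, hft, hfs, -, hf⟩ := exists_continuous_one_zero_of_isCompact_of_isGδ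
      isCompact_singleton ht (isClosed_singleton (x := s)) (Set.disjoint_singleton.2 hts)
    obtain ⟨g, hgs, hgt, -, hg⟩ := exists_continuous_one_zero_of_isCompact_of_isGδ
      isCompact_singleton hs (isClosed_singleton (x := t)) (Set.disjoint_singleton.2 hts.symm)
    have hf_iff (u : K) : u = t ↔ f u = 1 := Set.ext_iff.1 hft u
    have hg_iff (u : K) : u = s ↔ g u = 1 := Set.ext_iff.1 hgs u
    have hft1 : f t = 1 := (hf_iff t).1 rfl
    have hgs1 : g s = 1 := (hg_iff s).1 rfl
    have hfs0 : f s = 0 := hfs rfl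
    have hgt0 : g t = 0 := hgt rfl
    refine ⟨(1 / 2 : ℝ) • (f - g), ?_, ?_, fun u hut hus => ?_⟩
    · simp [hft1, hgt0]
    · simp [hfs0, hgs1]
    · have hfu : f u < 1 := lt_of_le_of_ne (hf u).2 (mt (hf_iff u).2 hut)
      have hgu : g u < 1 := lt_of_le_of_ne (hg u).2 (mt (hg_iff u).2 hus)
      have hf0 : 0 ≤ f u := (hf u).1
      have hg0 : 0 ≤ g u := (hg u).1
      simp only [ContinuousMap.smul_apply, ContinuousMap.sub_apply, smul_eq_mul]
      constructor <;> linarith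
end

section
/- Let K be a compact Hausdorff space. Every point mass δ_t (t ∈ K) is a weak* exposed point of the unit ball B₀ = { μ : max{μ⁺(K), μ⁻(K)} ≤ 1 } of the regular Borel signed measures — meaning that for every t ∈ K there exists x ∈ C(K) with ‖x‖_d = 1, x(t) = 1, and ∫_K x dμ < 1 for every μ ∈ B₀ with μ ≠ δ_t — if and only if K is first countable. -/
open MeasureTheory

/-- A Dirac mass is inner regular with respect to compact sets. -/
theorem dirac_innerRegular {K : Type*} [TopologicalSpace K] [MeasurableSpace K] (t : K) :
    (Measure.dirac t).InnerRegular := by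
  refine ⟨fun A hA r hr => ?_⟩
  have ht : t ∈ A := by
    by_contra h
    simp [Measure.dirac_apply' t hA, h] at hr
  refine ⟨{t}, by simpa using ht, isCompact_singleton, ?_⟩
  rw [Measure.dirac_apply_of_mem ht] at hr
  rwa [Measure.dirac_apply_of_mem (Set.mem_singleton t)]

/-- The Jordan decomposition of the signed measure of a positive finite measure. -/
theorem toJordanDecomposition_toSignedMeasure_of_measure {K : Type*} [MeasurableSpace K]
    (ν : Measure K) [IsFiniteMeasure ν] :
    ν.toSignedMeasure.toJordanDecomposition =
      { posPart := ν, negPart := 0, mutuallySingular := Measure.MutuallySingular.zero_right } := by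
  apply SignedMeasure.toJordanDecomposition_eq
  simp [JordanDecomposition.toSignedMeasure]

/-- A continuous real function on a compact space that attains the value `a` only at `t` yields a
countable neighbourhood basis at `t`. -/
theorem nhds_isCountablyGenerated_of_continuous {K : Type*} [TopologicalSpace K] [CompactSpace K]
    {x : K → ℝ} (hx : Continuous x) {t : K} (h : ∀ s, x s = x t → s = t) :
    (nhds t).IsCountablyGenerated := by
  have heq : nhds t = Filter.comap x (nhds (x t)) := by
    refine le_antisymm hx.continuousAt.le_comap (le_nhds_of_unique_clusterPt fun s hs => h s ?_)
    have h1 : ClusterPt (x s) (nhds (x t)) := hs.map hx.continuousAt Filter.tendsto_comap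
    exact eq_of_nhds_neBot h1
  rw [heq]
  infer_instance

/-- A finite measure concentrated at a point, of total mass one, is the Dirac mass. -/
theorem eq_dirac_of_ae_eq {K : Type*} [MeasurableSpace K] {ν : Measure K} {t : K}
    (h : ∀ᵐ u ∂ν, u = t) (h1 : ν Set.univ = 1) : ν = Measure.dirac t := by
  have hr : ν.restrict {t} = ν := Measure.restrict_eq_self_of_ae_mem h
  have ht : ν {t} = 1 := by
    rw [← h1]
    exact measure_congr (Filter.eventuallyEq_univ.2 h)
  rw [← hr, Measure.restrict_singleton, ht, one_smul]

/-- A function with values in `(0, 1]` attaining the value `1` only at `t` exposes the Dirac mass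
at `t`. -/
theorem integral_sub_integral_lt_one {K : Type*} [TopologicalSpace K] [CompactSpace K]
    [MeasurableSpace K] [BorelSpace K] {x : C(K, ℝ)} {t : K} (hpos : ∀ u, 0 < x u)
    (hle : ∀ u, x u ≤ 1) (huniq : ∀ u, x u = 1 → u = t) {μ : SignedMeasure K}
    (hμ : (μ.toJordanDecomposition.posPart Set.univ).toReal ≤ 1)
    (hne : μ ≠ (Measure.dirac t).toSignedMeasure) :
    (∫ u, x u ∂μ.toJordanDecomposition.posPart)
      - (∫ u, x u ∂μ.toJordanDecomposition.negPart) < 1 := by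
  by_contra! hge
  apply hne
  have hint : ∀ (ν : Measure K) [IsFiniteMeasure ν], Integrable x ν := fun ν _ =>
    Integrable.of_bound x.continuous.measurable.aestronglyMeasurable 1
      (.of_forall fun u => by rw [Real.norm_of_nonneg (hpos u).le]; exact hle u)
  set P := μ.toJordanDecomposition.posPart with hP
  set N := μ.toJordanDecomposition.negPart with hN
  have hNnonneg : 0 ≤ ∫ u, x u ∂N := integral_nonneg fun u => (hpos u).le
  have hgap : ∫ u, (1 - x u) ∂P = (P Set.univ).toReal - ∫ u, x u ∂P := by
    rw [integral_sub (integrable_const _) (hint P)]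
    simp [Measure.real]
  have hgap0 : 0 ≤ ∫ u, (1 - x u) ∂P := integral_nonneg fun u => sub_nonneg.2 (hle u)
  have hN0 : N = 0 := by
    have h0 : ∫ u, x u ∂N = 0 := by linarith
    rw [integral_eq_zero_iff_of_nonneg (fun u => (hpos u).le) (hint N)] at h0
    rw [← ae_eq_bot, ← Filter.eventually_false_iff_eq_bot]
    filter_upwards [h0] with u hu
    exact (hpos u).ne' hu
  have hPt : P = Measure.dirac t := by
    apply eq_dirac_of_ae_eq
    · have h0 : ∫ u, (1 - x u) ∂P = 0 := by linarith
      rw [integral_eq_zero_iff_of_nonneg (fun u => sub_nonneg.2 (hle u))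
        ((integrable_const _).sub (hint P))] at h0
      filter_upwards [h0] with u hu
      exact huniq u (sub_eq_zero.1 hu).symm
    · rw [← ENNReal.toReal_eq_one_iff]
      linarith
  rw [← μ.toSignedMeasure_toJordanDecomposition]
  ext A hA
  rw [JordanDecomposition.toSignedMeasure, Measure.toSignedMeasure_sub_apply hA, ← hP, ← hN, hN0,
    hPt, Measure.toSignedMeasure_apply_measurable hA]
  simp

/-- Every point mass `δ_t` is a weak* exposed point of the unit ball
`B₀ = {μ regular : max {μ⁺(K), μ⁻(K)} ≤ 1}` of the regular Borel signed measures on a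
compact Hausdorff space `K` if and only if `K` is first countable. -/
theorem dirac_weak_star_exposed_iff_first_countable
    {K : Type*} [TopologicalSpace K] [CompactSpace K] [T2Space K]
    [MeasurableSpace K] [BorelSpace K] :
    (∀ t : K, ∃ x : C(K, ℝ),
        ‖x ⊔ 0‖ + ‖(-x) ⊔ 0‖ = 1 ∧ x t = 1 ∧
        ∀ μ : SignedMeasure K, μ.totalVariation.Regular →
          max (μ.toJordanDecomposition.posPart Set.univ).toReal
              (μ.toJordanDecomposition.negPart Set.univ).toReal ≤ 1 →
          μ ≠ (Measure.dirac t).toSignedMeasure →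
          (∫ u, x u ∂μ.toJordanDecomposition.posPart)
            - (∫ u, x u ∂μ.toJordanDecomposition.negPart) < 1) ↔
      FirstCountableTopology K := by
  constructor
  · intro h
    refine ⟨fun t => ?_⟩
    obtain ⟨x, -, hxt, hx⟩ := h t
    refine nhds_isCountablyGenerated_of_continuous x.continuous fun s hs => ?_
    by_contra hst
    have hreg : (Measure.dirac s).Regular := by
      have := dirac_innerRegular s
      infer_instance
    have hlt := hx (Measure.dirac s).toSignedMeasure
      (by simpa [SignedMeasure.totalVariation, toJordanDecomposition_toSignedMeasure_of_measure]
        using hreg)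
      (by simp [toJordanDecomposition_toSignedMeasure_of_measure])
      (fun heq => by
        have h1 := congrArg (fun ν : SignedMeasure K => ν {s}) heq
        simp [Measure.real, Ne.symm hst] at h1)
    simp [toJordanDecomposition_toSignedMeasure_of_measure, hs, hxt] at hlt
  · intro _ t
    obtain ⟨f, hf, -, -, hf01⟩ := exists_continuous_one_zero_of_isCompact_of_isGδ
      (isCompact_singleton (x := t)) (IsGδ.singleton t) isClosed_empty (Set.disjoint_empty _)
    have hft : f t = 1 := by
      have : t ∈ f ⁻¹' {1} := hf ▸ Set.mem_singleton t
      exact this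
    let x : C(K, ℝ) := ⟨fun u => (1 + f u) / 2, by fun_prop⟩
    have hxt : x t = 1 := by simp [x, hft]
    have hpos : ∀ u, 0 < x u := fun u => by
      have := (hf01 u).1
      simp only [x, ContinuousMap.coe_mk]
      linarith
    have hle : ∀ u, x u ≤ 1 := fun u => by
      have := (hf01 u).2
      simp only [x, ContinuousMap.coe_mk]
      linarith
    refine ⟨x, ?_, hxt, fun μ _ hμ hne => integral_sub_integral_lt_one hpos hle (fun u hu => ?_)
      ((le_max_left _ _).trans hμ) hne⟩
    · have hsup : x ⊔ 0 = x := sup_eq_left.2 fun u => (hpos u).le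
      have hneg : (-x) ⊔ 0 = 0 := sup_eq_right.2 fun u => neg_nonpos.2 (hpos u).le
      rw [hsup, hneg, norm_zero, add_zero]
      refine le_antisymm ((ContinuousMap.norm_le _ zero_le_one).2 fun u => ?_) ?_
      · rw [Real.norm_of_nonneg (hpos u).le]
        exact hle u
      · simpa [hxt] using x.norm_coe_le_norm t
    · have : u ∈ f ⁻¹' {1} := by
        simp only [x, ContinuousMap.coe_mk] at hu
        change f u = 1
        linarith
      rwa [← hf] at this
end

section
/- Let K be a compact Hausdorff space, t ∈ K, and x ∈ C(K) with ‖x‖_d = 1. Then x weak* exposes the unit ball B₀ = { μ : max{μ⁺(K), μ⁻(K)} ≤ 1 } at δ_t — i.e. x(t) = 1 and ∫_K x dμ < 1 for every μ ∈ B₀ with μ ≠ δ_t — if and only if ρ(x) < 1 and t is the unique point of K with x(t) = 1, where ρ(x) = sup{|x(u) − x(v)| : u, v ∈ K} is the diameter seminorm. -/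
open MeasureTheory

/-- A Dirac measure is inner regular, since singletons are compact. -/
theorem innerRegular_dirac {K : Type*} [TopologicalSpace K] [T2Space K]
    [MeasurableSpace K] [BorelSpace K] (t : K) : (Measure.dirac t).InnerRegular := by
  refine ⟨fun s _ r hr => ?_⟩
  by_cases hts : t ∈ s
  · refine ⟨{t}, Set.singleton_subset_iff.2 hts, isCompact_singleton, ?_⟩
    rw [Measure.dirac_apply_of_mem hts] at hr
    rwa [Measure.dirac_apply_of_mem (Set.mem_singleton t)]
  · simp [Measure.dirac_apply, hts] at hr

/-- If `0 ≤ x ≤ 1` attains the value `1` only at `t`, a measure of mass at most one whose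
`x`-integral is at least one is the Dirac measure at `t`. -/
theorem eq_dirac_of_one_le_integral {K : Type*} [TopologicalSpace K] [CompactSpace K] [T2Space K]
    [MeasurableSpace K] [BorelSpace K] {t : K} {x : C(K, ℝ)} (hle : ∀ u, x u ≤ 1)
    (huniq : ∀ s, x s = 1 → s = t) {p : Measure K} [IsFiniteMeasure p]
    (hp : p.real Set.univ ≤ 1) (hint : 1 ≤ ∫ u, x u ∂p) : p = Measure.dirac t := by
  have hxi : Integrable (fun u => x u) p :=
    x.continuous.integrable_of_hasCompactSupport (HasCompactSupport.of_compactSpace _)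
  have hsub : ∫ u, (1 - x u) ∂p = p.real Set.univ - ∫ u, x u ∂p := by
    rw [integral_sub (integrable_const 1) hxi]
    simp
  have hnn : 0 ≤ ∫ u, (1 - x u) ∂p := integral_nonneg fun u => sub_nonneg.2 (hle u)
  have hzero : ∫ u, (1 - x u) ∂p = 0 := by linarith
  have hmass : p.real Set.univ = 1 := by linarith
  have hae := (integral_eq_zero_iff_of_nonneg (fun u => sub_nonneg.2 (hle u))
    ((integrable_const 1).sub hxi)).1 hzero
  have hmem : ∀ᵐ u ∂p, u ∈ ({t} : Finset K) := by
    filter_upwards [hae] with u hu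
    exact Finset.mem_singleton.2 (huniq u (sub_eq_zero.1 hu).symm)
  have hcompl : p.real {t}ᶜ = 0 := by
    rw [measureReal_eq_zero_iff]
    simpa [ae_iff, Set.compl_def] using hmem
  have hpt : p {t} = 1 := by
    have h := measureReal_add_measureReal_compl (μ := p) (measurableSet_singleton t)
    rw [hcompl, add_zero, hmass] at h
    rw [← ENNReal.toReal_eq_one_iff]
    exact h
  rw [Measure.ae_mem_finset_iff] at hmem
  simpa [hpt] using hmem

/-- Let `K` be a compact Hausdorff space, `t ∈ K` and `x ∈ C(K)` with `‖x‖_d = 1`.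
Then `x` weak* exposes the unit ball `B₀ = {μ regular : max {μ⁺(K), μ⁻(K)} ≤ 1}` at
`δ_t` if and only if `ρ(x) < 1` and `t` is the unique point of `K` with `x t = 1`. -/
theorem weak_star_exposes_at_dirac_iff
    {K : Type*} [TopologicalSpace K] [CompactSpace K] [T2Space K]
    [MeasurableSpace K] [BorelSpace K]
    (t : K) (x : C(K, ℝ)) (hx : ‖x ⊔ 0‖ + ‖(-x) ⊔ 0‖ = 1) :
    (x t = 1 ∧
      ∀ μ : SignedMeasure K, μ.totalVariation.Regular →
        max (μ.toJordanDecomposition.posPart Set.univ).toReal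
            (μ.toJordanDecomposition.negPart Set.univ).toReal ≤ 1 →
        μ ≠ (Measure.dirac t).toSignedMeasure →
        (∫ u, x u ∂μ.toJordanDecomposition.posPart)
          - (∫ u, x u ∂μ.toJordanDecomposition.negPart) < 1) ↔
      (sSup {r : ℝ | ∃ u v : K, r = |x u - x v|} < 1 ∧
        x t = 1 ∧ ∀ s : K, x s = 1 → s = t) := by
  have hrange : x t = 1 → ∀ u, 0 ≤ x u ∧ x u ≤ 1 := by
    intro hxt u
    have h1 := (x ⊔ 0).norm_coe_le_norm t
    have h2 := (x ⊔ 0).norm_coe_le_norm u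
    have h3 := ((-x) ⊔ 0).norm_coe_le_norm u
    simp only [ContinuousMap.sup_apply, ContinuousMap.zero_apply, ContinuousMap.neg_apply,
      Real.norm_eq_abs, hxt] at h1 h2 h3
    have h4 := (le_abs_self _).trans h1
    have h5 := (le_abs_self _).trans h2
    have h6 := (le_abs_self _).trans h3
    have h7 := le_max_left (1 : ℝ) 0
    have h8 := le_max_left (x u) 0
    have h9 := le_max_left (-x u) 0
    have h10 := norm_nonneg ((-x) ⊔ 0)
    constructor <;> linarith
  let δ : JordanDecomposition K := ⟨Measure.dirac t, 0, Measure.MutuallySingular.zero_right⟩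
  have hδ : δ.toSignedMeasure = (Measure.dirac t).toSignedMeasure := by
    simp [δ, JordanDecomposition.toSignedMeasure]
  constructor
  · rintro ⟨hxt, hexp⟩
    have hjordan : ∀ j : JordanDecomposition K, (j.posPart + j.negPart).InnerRegular →
        j.posPart.real Set.univ ≤ 1 → j.negPart.real Set.univ ≤ 1 → j ≠ δ →
        (∫ u, x u ∂j.posPart) - (∫ u, x u ∂j.negPart) < 1 := by
      intro j hreg hpos hneg hne
      have h := hexp j.toSignedMeasure
      rw [SignedMeasure.totalVariation, JordanDecomposition.toJordanDecomposition_toSignedMeasure,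
        ← hδ] at h
      exact h inferInstance (max_le hpos hneg)
        (JordanDecomposition.toSignedMeasure_injective.ne hne)
    have := innerRegular_dirac t
    have hpos : ∀ s, 0 < x s := by
      intro s
      refine lt_of_le_of_ne (hrange hxt s).1 fun hs => ?_
      have hts : t ≠ s := by
        rintro rfl
        linarith
      have := innerRegular_dirac s
      have hsing : Measure.dirac t ⟂ₘ Measure.dirac s :=
        ⟨{t}ᶜ, (measurableSet_singleton t).compl, by simp, by simp [hts.symm]⟩
      have h := hjordan ⟨Measure.dirac t, Measure.dirac s, hsing⟩ inferInstance (by simp) (by simp) fun h => by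
          simpa [δ] using congrArg JordanDecomposition.negPart h
      simp [hxt, ← hs] at h
    refine ⟨?_, hxt, fun s hs => ?_⟩
    · obtain ⟨m, -, hm⟩ := isCompact_univ.exists_isMinOn ⟨t, Set.mem_univ t⟩
        x.continuous.continuousOn
      refine lt_of_le_of_lt (csSup_le ⟨_, t, t, rfl⟩ ?_) (sub_lt_self 1 (hpos m))
      rintro r ⟨u, v, rfl⟩
      have hu : x m ≤ x u := hm (Set.mem_univ u)
      have hv : x m ≤ x v := hm (Set.mem_univ v)
      have hu' := (hrange hxt u).2
      have hv' := (hrange hxt v).2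
      rw [abs_le]
      constructor <;> linarith
    · by_contra hst
      have := innerRegular_dirac s
      have h := hjordan ⟨Measure.dirac s, 0, Measure.MutuallySingular.zero_right⟩
        inferInstance (by simp) (by simp) fun h => by
          have h' : Measure.dirac s = Measure.dirac t :=
            congrArg JordanDecomposition.posPart h
          exact hst (dirac_eq_dirac_iff.1 h')
      simp [hs] at h
  · rintro ⟨hρ, hxt, huniq⟩
    refine ⟨hxt, fun μ _ hμ hne => ?_⟩
    by_contra! hge
    obtain ⟨hp, hn⟩ := max_le_iff.1 hμ
    set j := μ.toJordanDecomposition with hj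
    have hxi : Integrable (fun u => x u) j.negPart :=
      x.continuous.integrable_of_hasCompactSupport (HasCompactSupport.of_compactSpace _)
    have hneg : 0 ≤ ∫ u, x u ∂j.negPart := integral_nonneg fun u => (hrange hxt u).1
    have hposPart : j.posPart = Measure.dirac t :=
      eq_dirac_of_one_le_integral (fun u => (hrange hxt u).2) huniq hp (by linarith)
    have hpos : ∀ u, 0 < x u := by
      intro u
      have hbdd : BddAbove {r : ℝ | ∃ u v : K, r = |x u - x v|} := by
        refine ⟨1, ?_⟩
        rintro r ⟨u, v, rfl⟩
        have hu := hrange hxt u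
        have hv := hrange hxt v
        rw [abs_le]
        constructor <;> linarith
      have h := (le_abs_self _).trans (le_csSup hbdd ⟨t, u, rfl⟩)
      linarith
    have hnegzero : ∫ u, x u ∂j.negPart = 0 := by
      rw [hposPart, integral_dirac, hxt] at hge
      linarith
    have hae := (integral_eq_zero_iff_of_nonneg (fun u => (hrange hxt u).1) hxi).1 hnegzero
    have hnegPart : j.negPart = 0 := by
      rw [← ae_eq_bot, ← Filter.eventually_false_iff_eq_bot]
      filter_upwards [hae] with u hu
      exact (hpos u).ne' hu
    apply hne
    rw [← hδ, ← μ.toSignedMeasure_toJordanDecomposition, ← hj]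
    exact congrArg _ (JordanDecomposition.ext hposPart hnegPart)
end

section
/- Let K be a compact Hausdorff space and t ∈ K. The point mass δ_t is a weak* strongly exposed point of the unit ball B₀ = { μ : max{μ⁺(K), μ⁻(K)} ≤ 1 } — meaning there exists x ∈ C(K) with ‖x‖_d = 1 and x(t) = 1 such that every sequence (μ_n) in B₀ with ∫_K x dμ_n → 1 converges to δ_t in the total variation norm — if and only if t is an isolated point of K. -/
open MeasureTheory Filter Topology

namespace MeasureTheory

lemma Measure.innerRegular_dirac {α : Type*} [TopologicalSpace α] [MeasurableSpace α] (a : α) :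
    (Measure.dirac a).InnerRegular where
  innerRegular := by
    intro s hs r hr
    rw [Measure.dirac_apply' a hs] at hr
    by_cases ha : a ∈ s
    · refine ⟨{a}, by simpa using ha, isCompact_singleton, hr.trans_le ?_⟩
      simp [ha]
    · simp [ha] at hr

/-- The Jordan decomposition of a finite positive measure, with vanishing negative part. -/
def JordanDecomposition.ofMeasure {α : Type*} [MeasurableSpace α] (μ : Measure α)
    [IsFiniteMeasure μ] : JordanDecomposition α where
  posPart := μ
  negPart := 0
  mutuallySingular := Measure.MutuallySingular.zero_right

namespace SignedMeasure

variable {α : Type*} [MeasurableSpace α]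

lemma toJordanDecomposition_toSignedMeasure_of_measure (μ : Measure α) [IsFiniteMeasure μ] :
    μ.toSignedMeasure.toJordanDecomposition = JordanDecomposition.ofMeasure μ := by
  apply toJordanDecomposition_eq
  simp [JordanDecomposition.toSignedMeasure, JordanDecomposition.ofMeasure]

lemma totalVariation_univ_toReal (s : SignedMeasure α) :
    (s.totalVariation Set.univ).toReal =
      s.toJordanDecomposition.posPart.real Set.univ +
        s.toJordanDecomposition.negPart.real Set.univ := by
  rw [totalVariation, Measure.add_apply,
    ENNReal.toReal_add (measure_ne_top _ _) (measure_ne_top _ _)]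
  rfl

lemma apply_le_totalVariation_univ (s : SignedMeasure α) {E : Set α} (hE : MeasurableSet E) :
    s E ≤ (s.totalVariation Set.univ).toReal := by
  rw [totalVariation_univ_toReal, apply_eq_posPart_real_sub_negPart_real s hE]
  have h₁ : s.toJordanDecomposition.posPart.real E ≤
    s.toJordanDecomposition.posPart.real Set.univ :=
    measureReal_mono (Set.subset_univ E)
  have h₂ : 0 ≤ s.toJordanDecomposition.negPart.real E := measureReal_nonneg
  have h₃ : 0 ≤ s.toJordanDecomposition.negPart.real Set.univ := measureReal_nonneg
  linarith

lemma totalVariation_univ_le_of_forall_abs_le (s : SignedMeasure α) {c : ℝ}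
    (h : ∀ E, MeasurableSet E → |s E| ≤ c) :
    (s.totalVariation Set.univ).toReal ≤ 2 * c := by
  obtain ⟨S, hS, hpos, hneg⟩ := s.toJordanDecomposition.mutuallySingular
  have h₁ := h S hS
  have h₂ := h Sᶜ hS.compl
  rw [apply_eq_posPart_real_sub_negPart_real s hS] at h₁
  rw [apply_eq_posPart_real_sub_negPart_real s hS.compl] at h₂
  rw [totalVariation_univ_toReal, ← measureReal_add_measureReal_compl hS,
    ← measureReal_add_measureReal_compl (μ := s.toJordanDecomposition.negPart) hS]
  have hpos' : s.toJordanDecomposition.posPart.real S = 0 := by simp [measureReal_def, hpos]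
  have hneg' : s.toJordanDecomposition.negPart.real Sᶜ = 0 := by simp [measureReal_def, hneg]
  rw [hpos'] at h₁ ⊢
  rw [hneg'] at h₂ ⊢
  have := abs_le.1 h₁
  have := abs_le.1 h₂
  linarith

lemma abs_sub_dirac_apply_le [MeasurableSingletonClass α] (s : SignedMeasure α) (t : α)
    (hs : s.toJordanDecomposition.posPart.real Set.univ ≤ 1) {E : Set α} (hE : MeasurableSet E) :
    |(s - (Measure.dirac t).toSignedMeasure) E| ≤
      (1 - s.toJordanDecomposition.posPart.real {t}) +
        s.toJordanDecomposition.negPart.real Set.univ := by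
  rw [_root_.sub_apply, apply_eq_posPart_real_sub_negPart_real s hE,
    Measure.toSignedMeasure_apply_measurable hE]
  have hn₀ : 0 ≤ s.toJordanDecomposition.negPart.real E := measureReal_nonneg
  have hn : s.toJordanDecomposition.negPart.real E ≤
    s.toJordanDecomposition.negPart.real Set.univ := measureReal_mono (Set.subset_univ E)
  have hp₀ : 0 ≤ s.toJordanDecomposition.posPart.real E := measureReal_nonneg
  have hp : s.toJordanDecomposition.posPart.real E ≤
    s.toJordanDecomposition.posPart.real Set.univ := measureReal_mono (Set.subset_univ E)
  have ht₁ : s.toJordanDecomposition.posPart.real {t} ≤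
    s.toJordanDecomposition.posPart.real Set.univ := measureReal_mono (Set.subset_univ _)
  by_cases ht : t ∈ E
  · have hd : (Measure.dirac t).real E = 1 := by simp [measureReal_def, ht]
    have : s.toJordanDecomposition.posPart.real {t} ≤ s.toJordanDecomposition.posPart.real E :=
      measureReal_mono (by simpa using ht)
    rw [hd, abs_le]
    constructor <;> linarith
  · have hd : (Measure.dirac t).real E = 0 := by
      simp [measureReal_def, Measure.dirac_apply' t hE, ht]
    have := measureReal_add_measureReal_compl (μ := s.toJordanDecomposition.posPart)
      (measurableSet_singleton t)
    have : s.toJordanDecomposition.posPart.real E ≤ s.toJordanDecomposition.posPart.real {t}ᶜ :=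
      measureReal_mono (by simpa using ht)
    rw [hd, abs_le]
    constructor <;> linarith

end SignedMeasure

end MeasureTheory

/-- The function equal to `1` at an isolated point `t` and to `1 / 2` elsewhere. -/
noncomputable def isolatedPeak {K : Type*} [TopologicalSpace K] [T1Space K] {t : K}
    (ht : IsOpen ({t} : Set K)) : C(K, ℝ) where
  toFun u := 1 / 2 + ({t} : Set K).indicator (fun _ ↦ 1 / 2) u
  continuous_toFun :=
    continuous_const.add (continuous_const.indicator (IsClopen.frontier_eq
      ⟨isClosed_singleton, ht⟩ ▸ by simp))

section isolatedPeak

variable {K : Type*} [TopologicalSpace K] [T1Space K] {t : K} (ht : IsOpen ({t} : Set K))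

lemma isolatedPeak_apply (u : K) :
    isolatedPeak ht u = 1 / 2 + ({t} : Set K).indicator (fun _ ↦ 1 / 2) u := rfl

lemma isolatedPeak_self : isolatedPeak ht t = 1 := by
  norm_num [isolatedPeak_apply]

lemma isolatedPeak_nonneg (u : K) : 0 ≤ isolatedPeak ht u := by
  by_cases h : u = t <;> norm_num [isolatedPeak_apply, h]

lemma isolatedPeak_le_one (u : K) : isolatedPeak ht u ≤ 1 := by
  by_cases h : u = t <;> norm_num [isolatedPeak_apply, h]

lemma norm_isolatedPeak_posPart_add_negPart [CompactSpace K] :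
    ‖isolatedPeak ht ⊔ 0‖ + ‖(-isolatedPeak ht) ⊔ 0‖ = 1 := by
  have h₁ : isolatedPeak ht ⊔ 0 = isolatedPeak ht :=
    sup_eq_left.2 fun u ↦ isolatedPeak_nonneg ht u
  have h₂ : (-isolatedPeak ht) ⊔ 0 = 0 :=
    sup_eq_right.2 fun u ↦ neg_nonpos.2 (isolatedPeak_nonneg ht u)
  rw [h₁, h₂, norm_zero, add_zero]
  apply le_antisymm
  · refine (ContinuousMap.norm_le _ zero_le_one).2 fun u ↦ ?_
    rw [Real.norm_of_nonneg (isolatedPeak_nonneg ht u)]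
    exact isolatedPeak_le_one ht u
  · simpa [isolatedPeak_self] using (isolatedPeak ht).norm_coe_le_norm t

lemma integral_isolatedPeak [MeasurableSpace K] [MeasurableSingletonClass K] (μ : Measure K)
    [IsFiniteMeasure μ] :
    ∫ u, isolatedPeak ht u ∂μ = (μ.real Set.univ + μ.real {t}) / 2 := by
  simp only [isolatedPeak_apply]
  rw [integral_add (integrable_const _)
    ((integrable_const _).indicator (measurableSet_singleton t)),
    integral_indicator_const _ (measurableSet_singleton t)]
  simp only [integral_const, smul_eq_mul]
  ring

end isolatedPeak

/-- The point mass `δ_t` is a weak* strongly exposed point of the unit ball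
`B₀ = {μ regular : max {μ⁺(K), μ⁻(K)} ≤ 1}` of the regular Borel signed measures on a
compact Hausdorff space `K` if and only if `t` is an isolated point of `K`. -/
theorem dirac_weak_star_strongly_exposed_iff_isolated
    {K : Type*} [TopologicalSpace K] [CompactSpace K] [T2Space K]
    [MeasurableSpace K] [BorelSpace K] (t : K) :
    (∃ x : C(K, ℝ), ‖x ⊔ 0‖ + ‖(-x) ⊔ 0‖ = 1 ∧ x t = 1 ∧
        ∀ μs : ℕ → SignedMeasure K,
          (∀ n, (μs n).totalVariation.Regular ∧
            max ((μs n).toJordanDecomposition.posPart Set.univ).toReal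
                ((μs n).toJordanDecomposition.negPart Set.univ).toReal ≤ 1) →
          Tendsto (fun n =>
              (∫ u, x u ∂(μs n).toJordanDecomposition.posPart)
                - ∫ u, x u ∂(μs n).toJordanDecomposition.negPart)
            atTop (𝓝 1) →
          Tendsto (fun n =>
              ((μs n - (Measure.dirac t).toSignedMeasure).totalVariation Set.univ).toReal)
            atTop (𝓝 0)) ↔
      IsOpen ({t} : Set K) := by
  constructor
  · rintro ⟨x, -, hxt, hx⟩
    by_contra hopen
    have hne : ∀ n : ℕ, ∃ s : K, s ≠ t ∧ |x s - 1| < 1 / ((n : ℝ) + 1) := by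
      intro n
      by_contra! hcon
      apply hopen
      have hU : IsOpen {s : K | |x s - 1| < 1 / ((n : ℝ) + 1)} :=
        isOpen_lt (by fun_prop) continuous_const
      convert hU
      ext s
      refine ⟨?_, fun hs ↦ ?_⟩
      · rintro rfl
        simp only [Set.mem_ofPred_eq, hxt, sub_self, abs_zero]
        positivity
      · by_contra hst
        exact (hcon s hst).not_gt hs
    choose s hst hs using hne
    have hlim := hx (fun n ↦ (Measure.dirac (s n)).toSignedMeasure) ?_ ?_
    · have hge : ∀ n, 1 ≤ (((Measure.dirac (s n)).toSignedMeasure -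
          (Measure.dirac t).toSignedMeasure).totalVariation Set.univ).toReal := by
        intro n
        refine le_trans (le_of_eq ?_) (SignedMeasure.apply_le_totalVariation_univ _
          (measurableSet_singleton (s n)))
        rw [Measure.toSignedMeasure_sub_apply (measurableSet_singleton _)]
        simp [measureReal_def, (hst n).symm]
      exact absurd (ge_of_tendsto' hlim hge) (by norm_num)
    · intro n
      have := Measure.innerRegular_dirac (s n)
      simp only [SignedMeasure.totalVariation,
        SignedMeasure.toJordanDecomposition_toSignedMeasure_of_measure,
        JordanDecomposition.ofMeasure, add_zero]
      exact ⟨inferInstance, by simp⟩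
    · simp only [SignedMeasure.toJordanDecomposition_toSignedMeasure_of_measure,
        JordanDecomposition.ofMeasure, integral_dirac, integral_zero_measure, sub_zero]
      rw [tendsto_iff_dist_tendsto_zero]
      exact squeeze_zero (fun _ ↦ dist_nonneg) (fun n ↦ (hs n).le)
        tendsto_one_div_add_atTop_nhds_zero_nat
  · intro ht
    refine ⟨isolatedPeak ht, norm_isolatedPeak_posPart_add_negPart ht, isolatedPeak_self ht, ?_⟩
    intro μs hμ hlim
    simp only [integral_isolatedPeak] at hlim
    have hbound := (hlim.const_sub 1).const_mul 4
    rw [sub_self, mul_zero] at hbound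
    refine squeeze_zero (fun _ ↦ ENNReal.toReal_nonneg) (fun n ↦ ?_) hbound
    have hp : (μs n).toJordanDecomposition.posPart.real Set.univ ≤ 1 :=
      (le_max_left _ _).trans (hμ n).2
    refine (SignedMeasure.totalVariation_univ_le_of_forall_abs_le _ fun E hE ↦
      SignedMeasure.abs_sub_dirac_apply_le (μs n) t hp hE).trans ?_
    have hq : (μs n).toJordanDecomposition.negPart.real {t} ≤
      (μs n).toJordanDecomposition.negPart.real Set.univ := measureReal_mono (Set.subset_univ _)
    have hq₀ : 0 ≤ (μs n).toJordanDecomposition.negPart.real {t} := measureReal_nonneg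
    linarith
end
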